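/- Let k ⊆ Ω be any subfield and let D ⊆ Ω be a finitely generated k-algebra. Then every basic open subset of Hom_k(D,k̄) is dense in the Zariski topology on Hom_k(D,k̄); in particular, every basic open subset of Hom_k(D,k̄) is nonempty. -/

import Mathlib

set_option linter.unusedSectionVars false
set_option linter.unusedVariables false

set_option linter.unusedSectionVars false
set_option linter.unusedVariables false

section Base

variable {Ω : Type*} [Field Ω] [IsAlgClosed Ω] [CharZero Ω]
variable (k : Type*) [Field k] [Algebra k Ω]
variable (kbar : Type*) [Field kbar] [Algebra k kbar] [IsAlgClosure k kbar]

/-- `Γ` is (the carrier set of) a finitely generated subgroup of the additive group `(Ω,+)`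
or of the multiplicative group `(Ω∖{0},·)`. -/
def IsFGAddOrMulSubgroup (Γ : Set Ω) : Prop :=
  (∃ H : AddSubgroup Ω, H.FG ∧ Γ = (H : Set Ω)) ∨
  (∃ H : Subgroup Ωˣ, H.FG ∧ Γ = Units.val '' (H : Set Ωˣ))

/-- The `D`-subalgebra `D[Γ]` of `Ω` generated by `Γ`. -/
def algAdj (D : Subalgebra k Ω) (Γ : Set Ω) : Subalgebra k Ω :=
  Algebra.adjoin k ((D : Set Ω) ∪ Γ)

theorem le_algAdj (D : Subalgebra k Ω) (Γ : Set Ω) : D ≤ algAdj k D Γ :=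
  fun _ hx => Algebra.subset_adjoin (Set.mem_union_left _ hx)

theorem subset_algAdj (D : Subalgebra k Ω) (Γ : Set Ω) :
    Γ ⊆ (algAdj k D Γ : Set Ω) :=
  fun _ hx => Algebra.subset_adjoin (Set.mem_union_right _ hx)

/-- `ℬ(D,Γ)`: restrictions to `D` of the `k`-homomorphisms `D[Γ] → k̄` injective on `Γ`. -/
def specB (D : Subalgebra k Ω) (Γ : Set Ω) : Set (↥D →ₐ[k] kbar) :=
  { φ | ∃ ψ : ↥(algAdj k D Γ) →ₐ[k] kbar,
      (∀ (a b : Ω) (ha : a ∈ Γ) (hb : b ∈ Γ),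
        ψ ⟨a, subset_algAdj k D Γ ha⟩ = ψ ⟨b, subset_algAdj k D Γ hb⟩ → a = b) ∧
      ψ.comp (Subalgebra.inclusion (le_algAdj k D Γ)) = φ }

/-- A basic open subset of `Hom_k(D,k̄)`: a finite intersection of sets `ℬ(D,Γ)`. -/
def IsBasicOpen (D : Subalgebra k Ω) (U : Set (↥D →ₐ[k] kbar)) : Prop :=
  ∃ s : Finset (Set Ω), s.Nonempty ∧ (∀ Γ ∈ s, IsFGAddOrMulSubgroup Γ) ∧
    U = ⋂ Γ ∈ s, specB k kbar D Γ

/-- The Zariski closed subset `𝒱(I)` of `Hom_k(D,k̄)`. -/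
def specV (D : Subalgebra k Ω) (I : Ideal ↥D) : Set (↥D →ₐ[k] kbar) :=
  { φ | ∀ a ∈ I, φ a = 0 }

/-- Density in the Zariski topology on `Hom_k(D,k̄)` (whose closed sets are the `𝒱(I)`). -/
def ZariskiDense (D : Subalgebra k Ω) (U : Set (↥D →ₐ[k] kbar)) : Prop :=
  ∀ I : Ideal ↥D, U ⊆ specV k kbar D I → specV k kbar D I = Set.univ

end Base

/-- A subgroup of a finite free abelian group of rank `|ι|` has image of cardinality at most
`p ^ |ι|` under any homomorphism to a group killed by `p`. -/
theorem ncard_image_le_of_subgroup {ι κ : Type*} [Fintype ι] [AddCommGroup κ] {p : ℕ}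
    [hp : Fact p.Prime] (hκ : ∀ x : κ, p • x = 0) (N : Submodule ℤ (ι → ℤ)) (Ψ : N →+ κ) :
    (Set.range Ψ).Finite ∧ (Set.range Ψ).ncard ≤ p ^ Fintype.card ι := by
  obtain ⟨n, b⟩ := Submodule.basisOfPid (Pi.basisFun ℤ ι) N
  have hn : n ≤ Fintype.card ι := by
    have h1 := Submodule.finrank_le N
    rw [Module.finrank_eq_card_basis b, Module.finrank_fintype_fun_eq_card, Fintype.card_fin] at h1
    exact h1
  let G : (Fin n → ZMod p) → κ := fun a => ∑ i, (a i).val • Ψ (b i)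
  have hsub : Set.range Ψ ⊆ Set.range G := by
    rintro _ ⟨x, rfl⟩
    refine ⟨fun i => ((b.repr x i : ℤ) : ZMod p), ?_⟩
    have hx : Ψ x = ∑ i, (b.repr x i) • Ψ (b i) := by
      conv_lhs => rw [← b.sum_repr x]
      rw [map_sum]
      exact Finset.sum_congr rfl fun i _ => map_zsmul Ψ _ _
    rw [hx]
    refine Finset.sum_congr rfl fun i _ => ?_
    have hz : (((((b.repr x i : ℤ) : ZMod p)).val : ℤ)) = b.repr x i % p := by
      rw [ZMod.val_intCast]
    rw [← natCast_zsmul, hz]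
    conv_rhs => rw [← Int.emod_add_mul_ediv (b.repr x i) p]
    rw [add_zsmul, mul_comm, mul_zsmul, natCast_zsmul, hκ, smul_zero, add_zero]
  have hfin : (Set.range G).Finite := Set.finite_range G
  refine ⟨hfin.subset hsub, (Set.ncard_le_ncard hsub hfin).trans ?_⟩
  calc (Set.range G).ncard ≤ Nat.card (Fin n → ZMod p) := by
        rw [← Set.image_univ, ← Set.ncard_univ]
        exact Set.ncard_image_le
    _ = p ^ n := by simp
    _ ≤ _ := Nat.pow_le_pow_right hp.out.pos hn

theorem finite_iUnion_of_monotone_of_ncard_le {α : Type*} (I : ℕ → Set α) (hI : Monotone I)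
    (C : ℕ) (hfin : ∀ k, (I k).Finite) (hC : ∀ k, (I k).ncard ≤ C) : (⋃ k, I k).Finite := by
  by_contra hinf
  obtain ⟨t, ht, hcard⟩ := Set.Infinite.exists_subset_card_eq hinf (C + 1)
  have h1 : ∀ x ∈ t, ∃ k, x ∈ I k := fun x hx => Set.mem_iUnion.1 (ht hx)
  choose! κ hκ using h1
  have h2 : (t : Set α) ⊆ I (t.sup κ) := fun x hx => hI (Finset.le_sup hx) (hκ x hx)
  have h3 := Set.ncard_le_ncard h2 (hfin _)
  rw [Set.ncard_coe_finset] at h3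
  have h4 := hC (t.sup κ)
  omega

/-- If `d ≡ 1 + p ^ e y` modulo `p ^ (e + 1)` with `e ≥ 2`, the `p`-th power is
`1 + p ^ (e + 1) y'` with `y' ≡ y` modulo `p`. -/
theorem one_add_pow_prime_pow {O : Type*} [CommRing O] (p e : ℕ) (y : O) :
    ∃ z : O, (1 + (p : O) ^ (e + 2) * y) ^ p = 1 + (p : O) ^ (e + 3) * (y + p * z) := by
  obtain ⟨q, hq⟩ : ∃ q : O, (1 + (p : O) ^ (e + 2) * y) ^ p
      = 1 + p * ((p : O) ^ (e + 2) * y) + ((p : O) ^ (e + 2) * y) ^ 2 * q := by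
    obtain ⟨q, hq⟩ := (Polynomial.X ^ p : Polynomial O).binomExpansion 1 ((p : O) ^ (e + 2) * y)
    refine ⟨q, ?_⟩
    simp [Polynomial.derivative_X_pow] at hq
    rw [hq]; ring
  refine ⟨p ^ e * y ^ 2 * q, ?_⟩
  rw [hq]; ring

section
open IsLocalRing

/-- The leading residues of `d - 1`, for `d ≡ 1 mod p²` in a finitely generated group of
units, form a finite set. -/
theorem finite_leading_residues {O : Type*} [CommRing O] [IsDomain O] [IsLocalRing O]
    [CharZero O] {p : ℕ} (hp : p.Prime) (hpm : (p : O) ∈ maximalIdeal O)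
    {ι : Type*} [Fintype ι] (u : ι → Oˣ) :
    {r : ResidueField O | ∃ (k : ℕ) (n : ι → ℤ) (y : O),
      ((∏ i, u i ^ n i : Oˣ) : O) = 1 + (p : O) ^ (k + 2) * y ∧ residue O y = r}.Finite := by
  have : Fact p.Prime := ⟨hp⟩
  have hp0 : (p : O) ≠ 0 := by exact_mod_cast hp.ne_zero
  have hres : residue O (p : O) = 0 := (residue_eq_zero_iff _).2 hpm
  let E : (ι → ℤ) → Oˣ := fun n => ∏ i, u i ^ n i
  have hE0 : E 0 = 1 := by simp [E]
  have hEadd : ∀ a b, E (a + b) = E a * E b := fun a b => by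
    simp [E, zpow_add, Finset.prod_mul_distrib]
  have hEneg : ∀ a, E (-a) * E a = 1 := fun a => by rw [← hEadd, neg_add_cancel, hE0]
  have hEmul : ∀ (a : ι → ℤ) (m : ℕ), E (m • a) = E a ^ m := fun a m => by
    induction m with
    | zero => simp [hE0]
    | succ m ih => rw [succ_nsmul, hEadd, ih, pow_succ]
  let I : ℕ → Set (ResidueField O) := fun k => {r | ∃ (n : ι → ℤ) (y : O),
      (E n : O) = 1 + (p : O) ^ (k + 2) * y ∧ residue O y = r}
  have hset : {r : ResidueField O | ∃ (k : ℕ) (n : ι → ℤ) (y : O),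
      ((∏ i, u i ^ n i : Oˣ) : O) = 1 + (p : O) ^ (k + 2) * y ∧ residue O y = r} = ⋃ k, I k := by
    ext r; simp [I, E]
  rw [hset]
  have key : ∀ k, (I k).Finite ∧ (I k).ncard ≤ p ^ Fintype.card ι := by
    intro k
    let N : AddSubgroup (ι → ℤ) :=
      { carrier := {n | ∃ y : O, (E n : O) = 1 + (p : O) ^ (k + 2) * y}
        zero_mem' := ⟨0, by simp [hE0]⟩
        add_mem' := by
          rintro a b ⟨y, hy⟩ ⟨z, hz⟩
          exact ⟨y + z + (p : O) ^ (k + 2) * y * z, by rw [hEadd]; push_cast; rw [hy, hz]; ring⟩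
        neg_mem' := by
          rintro a ⟨y, hy⟩
          have h1 : (E (-a) : O) * E a = 1 := by
            rw [← Units.val_mul, hEneg, Units.val_one]
          refine ⟨-(E (-a) : O) * y, ?_⟩
          rw [hy] at h1
          linear_combination h1 }
    have hN : ∀ n : N, ∃ y : O, (E n : O) = 1 + (p : O) ^ (k + 2) * y := fun n => n.2
    choose Y hY using hN
    have hcan : ∀ a b : O, (p : O) ^ (k + 2) * a = (p : O) ^ (k + 2) * b → a = b := fun a b h =>
      mul_left_cancel₀ (pow_ne_zero _ hp0) h
    let Ψ : N →+ ResidueField O := AddMonoidHom.mk' (fun n => residue O (Y n)) (by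
      intro a b
      have h1 : Y (a + b) = Y a + Y b + (p : O) ^ (k + 2) * Y a * Y b := by
        apply hcan
        have := hY (a + b)
        rw [AddSubgroup.coe_add, hEadd] at this
        push_cast at this
        rw [hY, hY] at this
        linear_combination -this
      rw [h1]
      simp [hres])
    have hκ : ∀ x : ResidueField O, p • x = 0 := by
      intro x
      rw [nsmul_eq_mul, ← map_natCast (residue O), hres, zero_mul]
    have h2 := ncard_image_le_of_subgroup hκ (AddSubgroup.toIntSubmodule N) Ψ
    have h3 : Set.range Ψ = I k := by
      ext r
      constructor
      · rintro ⟨n, rfl⟩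
        exact ⟨n, Y n, hY n, rfl⟩
      · rintro ⟨n, y, hy, rfl⟩
        refine ⟨⟨n, y, hy⟩, ?_⟩
        have : Y ⟨n, y, hy⟩ = y := by
          apply hcan
          have h5 : (E n : O) = 1 + (p : O) ^ (k + 2) * Y ⟨n, y, hy⟩ := hY ⟨n, y, hy⟩
          linear_combination hy - h5
        show residue O _ = _
        rw [this]
    exact h3 ▸ h2
  refine finite_iUnion_of_monotone_of_ncard_le I ?_ _ (fun k => (key k).1) (fun k => (key k).2)
  refine monotone_nat_of_le_succ fun k => ?_
  rintro r ⟨n, y, hy, rfl⟩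
  obtain ⟨z, hz⟩ := one_add_pow_prime_pow p k y
  refine ⟨p • n, y + p * z, ?_, by simp [hres]⟩
  rw [hEmul]
  push_cast
  rw [hy, hz]

end

section

open Polynomial IsLocalRing

section Bivariate

/-- The partial derivative with respect to the inner variable of a bivariate polynomial. -/
noncomputable def derivX (R : Type*) [CommRing R] : Derivation R R[X][X] R[X][X] :=
  PolynomialModule.equivPolynomialSelf.compDer (derivative' (R := R)).mapCoeffs

variable {R S : Type*} [CommRing R] [CommRing S]

theorem derivX_coeff (F : R[X][X]) (n : ℕ) : (derivX R F).coeff n = derivative (F.coeff n) := rfl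

@[simp] theorem derivX_C (a : R[X]) : derivX R (C a) = C (derivative a) := by
  ext n : 1
  rw [derivX_coeff, coeff_C, coeff_C]
  split_ifs <;> simp

@[simp] theorem derivX_X : derivX R (X : R[X][X]) = 0 := by
  ext n : 1
  rw [derivX_coeff, coeff_X]
  split_ifs <;> simp

theorem derivX_mul (F G : R[X][X]) : derivX R (F * G) = F * derivX R G + G * derivX R F := by
  simp

theorem derivX_map (φ : R →+* S) (F : R[X][X]) :
    derivX S (F.map (mapRingHom φ)) = (derivX R F).map (mapRingHom φ) := by
  ext n : 1
  simp [derivX_coeff, derivative_map]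

/-- First-order Taylor expansion of a bivariate polynomial. -/
theorem evalEval_add_mul (F : R[X][X]) (x y u w ε : R) :
    ∃ r, F.evalEval (x + ε * u) (y + ε * w) = F.evalEval x y
      + ε * (u * (derivX R F).evalEval x y + w * (derivative F).evalEval x y) + ε ^ 2 * r := by
  have hadd : ∀ F G : R[X][X], (∃ r, F.evalEval (x + ε * u) (y + ε * w) = F.evalEval x y
      + ε * (u * (derivX R F).evalEval x y + w * (derivative F).evalEval x y) + ε ^ 2 * r) →
      (∃ r, G.evalEval (x + ε * u) (y + ε * w) = G.evalEval x y
      + ε * (u * (derivX R G).evalEval x y + w * (derivative G).evalEval x y) + ε ^ 2 * r) →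
      ∃ r, (F + G).evalEval (x + ε * u) (y + ε * w) = (F + G).evalEval x y
      + ε * (u * (derivX R (F + G)).evalEval x y + w * (derivative (F + G)).evalEval x y)
      + ε ^ 2 * r := by
    rintro F G ⟨r, hr⟩ ⟨s, hs⟩
    refine ⟨r + s, ?_⟩
    simp only [map_add, evalEval_add]
    rw [hr, hs]; ring
  induction F using Polynomial.induction_on with
  | C a =>
    obtain ⟨r, hr⟩ := a.binomExpansion x (ε * u)
    refine ⟨u ^ 2 * r, ?_⟩
    simp only [derivX_C, derivative_C, evalEval_C, evalEval_zero]
    rw [hr]; ring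
  | add F G hF hG => exact hadd F G hF hG
  | monomial n a ih =>
    obtain ⟨r, hr⟩ := ih
    rw [pow_succ, ← mul_assoc]
    generalize C a * X ^ n = F at hr
    refine ⟨y * r + w * (u * (derivX R F).evalEval x y + w * (derivative F).evalEval x y)
      + ε * w * r, ?_⟩
    simp only [derivX_mul, derivX_X, derivative_mul, derivative_X, evalEval_mul, evalEval_add,
      evalEval_X, mul_zero, mul_one, evalEval_zero]
    rw [hr]; ring

end Bivariate

/-- A local domain in which monic nonconstant polynomials have roots satisfies a Hensel lemma
for arbitrary precision `m`. -/
theorem exists_root_of_isUnit_derivative {O : Type*} [CommRing O] [IsLocalRing O]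
    (hroot : ∀ P : O[X], P.Monic → P.natDegree ≠ 0 → ∃ x, P.eval x = 0)
    (m b : O) (P : O[X]) (hP : P.Monic) (hd : IsUnit ((derivative P).eval b))
    (hm : m ∣ P.eval b) : ∃ e, P.eval (b + m * e) = 0 := by
  induction hn : P.natDegree generalizing P with
  | zero =>
    rw [hP.natDegree_eq_zero.1 hn] at hd
    simp at hd
  | succ n ih =>
    obtain ⟨r, hr⟩ := hroot P hP (by omega)
    obtain ⟨Q, rfl⟩ := dvd_iff_isRoot.2 hr
    have hQ : Q.Monic := (monic_X_sub_C r).of_mul_monic_left hP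
    have hQn : Q.natDegree = n := by
      rw [(monic_X_sub_C r).natDegree_mul hQ, natDegree_X_sub_C] at hn
      omega
    simp only [derivative_mul, derivative_sub, derivative_X, derivative_C, sub_zero, one_mul,
      eval_add, eval_mul, eval_sub, eval_X, eval_C] at hd hm
    rcases isUnit_or_isUnit_of_isUnit_add hd with h | h
    · have h1 : m ∣ b - r := by rwa [h.dvd_mul_right] at hm
      obtain ⟨e, he⟩ := h1
      refine ⟨-e, ?_⟩
      have : b + m * -e = r := by linear_combination he
      rw [this]; simp
    · rw [IsUnit.mul_iff] at h
      rw [h.1.dvd_mul_left] at hm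
      obtain ⟨e, he⟩ := ih Q hQ h.2 hm hQn
      exact ⟨e, by simp [he]⟩

section

variable {O : Type*} [CommRing O] [IsLocalRing O]

/-- `v = 1 + q y` with `y` of residue `r`. -/
def IsPrincipalUnit (q : O) (v : Oˣ) (r : ResidueField O) : Prop :=
  ∃ y : O, (v : O) = 1 + q * y ∧ residue O y = r

variable {q : O} (hq : residue O q = 0)
include hq

theorem IsPrincipalUnit.mul {v w : Oˣ} {r s : ResidueField O} (hv : IsPrincipalUnit q v r)
    (hw : IsPrincipalUnit q w s) : IsPrincipalUnit q (v * w) (r + s) := by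
  obtain ⟨y, hy, rfl⟩ := hv
  obtain ⟨z, hz, rfl⟩ := hw
  refine ⟨y + z + q * y * z, ?_, by simp [hq]⟩
  push_cast
  rw [hy, hz]; ring

theorem IsPrincipalUnit.inv {v : Oˣ} {r : ResidueField O} (hv : IsPrincipalUnit q v r) :
    IsPrincipalUnit q v⁻¹ (-r) := by
  obtain ⟨y, hy, rfl⟩ := hv
  have h1 : (v : O) * (v⁻¹ : Oˣ) = 1 := v.mul_inv
  have h2 : ((v⁻¹ : Oˣ) : O) = 1 + q * -(y * (v⁻¹ : Oˣ)) := by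
    rw [hy] at h1
    linear_combination h1
  refine ⟨_, h2, ?_⟩
  have h3 : residue O ((v⁻¹ : Oˣ) : O) = 1 := by rw [h2]; simp [hq]
  simp [h3]

theorem IsPrincipalUnit.zpow {v : Oˣ} {r : ResidueField O} (hv : IsPrincipalUnit q v r)
    (n : ℤ) : IsPrincipalUnit q (v ^ n) (n * r) := by
  induction n with
  | zero => exact ⟨0, by simp, by simp⟩
  | succ n ih =>
    have := IsPrincipalUnit.mul hq ih hv
    rw [zpow_add_one]
    convert this using 1
    push_cast; ring
  | pred n ih =>
    have := IsPrincipalUnit.mul hq ih (IsPrincipalUnit.inv hq hv)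
    rw [zpow_sub_one]
    convert this using 1
    push_cast; ring

theorem IsPrincipalUnit.prod_zpow {J : Type*} [Fintype J] {v : J → Oˣ} {r : J → ResidueField O}
    (hv : ∀ j, IsPrincipalUnit q (v j) (r j)) (n : J → ℤ) :
    IsPrincipalUnit q (∏ j, v j ^ n j) (∑ j, n j * r j) := by
  classical
  induction (Finset.univ : Finset J) using Finset.induction_on with
  | empty => exact ⟨0, by simp, by simp⟩
  | insert a s ha ih =>
    rw [Finset.prod_insert ha, Finset.sum_insert ha]
    exact IsPrincipalUnit.mul hq (IsPrincipalUnit.zpow hq (hv a) _) ih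

end

theorem IsPrincipalUnit.pow_prime_pow {O : Type*} [CommRing O] [IsLocalRing O] {p : ℕ}
    (hpm : residue O (p : O) = 0) {v : Oˣ} {r : ResidueField O}
    (hv : IsPrincipalUnit ((p : O) ^ 2) v r) (k : ℕ) :
    IsPrincipalUnit ((p : O) ^ (k + 2)) (v ^ p ^ k) r := by
  induction k with
  | zero => simpa using hv
  | succ k ih =>
    obtain ⟨y, hy, rfl⟩ := ih
    obtain ⟨z, hz⟩ := one_add_pow_prime_pow p k y
    refine ⟨y + p * z, ?_, by simp [hpm]⟩
    rw [pow_succ, pow_mul, Units.val_pow_eq_pow_val, hy, hz]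

theorem exists_prime_pow_smul {J : Type*} [Fintype J] {p : ℕ} (hp : p.Prime) (n : J → ℤ)
    (hn : n ≠ 0) : ∃ (k : ℕ) (m : J → ℤ), n = (p : ℤ) ^ k • m ∧ ∃ j, ¬ (p : ℤ) ∣ m j := by
  classical
  obtain ⟨j, hj⟩ := Function.ne_iff.1 hn
  have hfin : ∀ k : ℕ, (∀ i, (p : ℤ) ^ k ∣ n i) → k ≤ (n j).natAbs := by
    intro k hk
    have h1 := hk j
    have h2 : p ^ k ∣ (n j).natAbs := by
      have := Int.natAbs_dvd_natAbs.2 h1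
      rwa [Int.natAbs_pow, Int.natAbs_natCast] at this
    have h3 := Nat.le_of_dvd (Int.natAbs_pos.2 hj) h2
    exact (Nat.lt_pow_self hp.one_lt).le.trans h3
  let k := Nat.findGreatest (fun k => ∀ i, (p : ℤ) ^ k ∣ n i) (n j).natAbs
  have hk : ∀ i, (p : ℤ) ^ k ∣ n i :=
    Nat.findGreatest_spec (P := fun k => ∀ i, (p : ℤ) ^ k ∣ n i) (Nat.zero_le _) (by simp)
  choose m hm using hk
  refine ⟨k, m, funext fun i => by simpa using hm i, ?_⟩
  by_contra! hall
  have h4 : ∀ i, (p : ℤ) ^ (k + 1) ∣ n i := fun i => by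
    obtain ⟨l, hl⟩ := hall i
    exact ⟨l, by rw [hm, hl]; ring⟩
  have h5 := Nat.le_findGreatest (P := fun k => ∀ i, (p : ℤ) ^ k ∣ n i) (hfin _ h4) h4
  have h6 : k + 1 ≤ k := h5
  omega

/-- The `p`-adic heart of the argument: specialization of a curve `g(X,Y) = 0` to a point at which
the functions `f j` become multiplicatively independent modulo the constants `c i`. -/
theorem exists_specialization_of_localRing {O : Type*} [CommRing O] [IsDomain O] [IsLocalRing O]
    [CharZero O] [Infinite (ResidueField O)]
    (hroot : ∀ P : O[X], P.Monic → P.natDegree ≠ 0 → ∃ x, P.eval x = 0)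
    {p : ℕ} (hp : p.Prime) (hpm : (p : O) ∈ maximalIdeal O)
    {J ι : Type*} [Fintype J] [Fintype ι] (g : O[X][X]) (hg : g.Monic) (hgd : g.natDegree ≠ 0)
    (h : O[X]) (f f' w : J → O[X][X]) (G : O[X][X]) (hf : ∀ j, g ∣ f j * f' j - C h)
    (hG : g ∣ derivative g * G - C h)
    (hw : ∀ j, g ∣ w j - (derivative g * derivX O (f j) - derivX O g * derivative (f j)) * f' j)
    {d : ℕ} [NeZero d] (M : J → Matrix (Fin d) (Fin d) O[X])
    (hM : ∀ j (a : Fin d), g ∣ w j * X ^ (a : ℕ) - ∑ b : Fin d, C (M j a b) * X ^ (b : ℕ))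
    (hh : h.map (residue O) ≠ 0)
    (hdet : ∀ n : J → ResidueField O, n ≠ 0 →
      (∑ j, C (n j) • (M j).map (Polynomial.map (residue O))).det ≠ 0)
    (c : ι → Oˣ) (Q : O → Prop) (hQ : ∀ t x : O, ∃ z, Q (t + p ^ 2 * x + p ^ 3 * z)) :
    ∃ τ b : O, Q τ ∧ g.evalEval τ b = 0 ∧ IsUnit (h.eval τ) ∧
      ∀ a : J → Oˣ, (∀ j, (a j : O) = (f j).evalEval τ b) → ∀ (n : J → ℤ) (m : ι → ℤ),
        (∏ j, a j ^ n j) * ∏ i, c i ^ m i = 1 → n = 0 := by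
  classical
  have : Fact p.Prime := ⟨hp⟩
  have hp0 : (p : O) ≠ 0 := by exact_mod_cast hp.ne_zero
  have hres : residue O (p : O) = 0 := (residue_eq_zero_iff _).2 hpm
  have hch : CharP (ResidueField O) p := by
    refine (CharP.charP_iff_prime_eq_zero hp).2 ?_
    rw [← map_natCast (residue O), hres]
  let N : (J → ZMod p) → J → ResidueField O := fun n j => ZMod.castHom dvd_rfl _ (n j)
  have hN : ∀ n, n ≠ 0 → N n ≠ 0 := fun n hn hz => hn <| funext fun j => by
    have := congrFun hz j
    exact (map_eq_zero _).1 this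
  let D : (J → ZMod p) → (ResidueField O)[X] := fun n =>
    (∑ j, C (N n j) • (M j).map (Polynomial.map (residue O))).det
  obtain ⟨t', ht'⟩ : ∃ t', (h.map (residue O) * ∏ n ∈ Finset.univ.filter (· ≠ 0), D n).eval t'
      ≠ 0 := by
    by_contra! hall
    have : (h.map (residue O) * ∏ n ∈ Finset.univ.filter (· ≠ 0), D n) = 0 :=
      Polynomial.funext fun x => by rw [hall, eval_zero]
    rcases mul_eq_zero.1 this with h1 | h1
    · exact hh h1
    · obtain ⟨n, hn, h2⟩ := Finset.prod_eq_zero_iff.1 h1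
      exact hdet _ (hN n (Finset.mem_filter.1 hn).2) h2
  obtain ⟨t, rfl⟩ := residue_surjective t'
  rw [eval_mul, eval_prod] at ht'
  have hD : ∀ n, n ≠ 0 → (D n).eval (residue O t) ≠ 0 := fun n hn =>
    Finset.prod_ne_zero_iff.1 (right_ne_zero_of_mul ht') n (by simp [hn])
  have hht : IsUnit (h.eval t) := by
    rw [← isUnit_map_iff (residue O), ← eval_map_apply, isUnit_iff_ne_zero]
    exact left_ne_zero_of_mul ht'
  have hgm : ∀ x : O, (g.map (evalRingHom x)).Monic ∧ (g.map (evalRingHom x)).natDegree ≠ 0 :=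
    fun x => ⟨hg.map _, by rwa [hg.natDegree_map]⟩
  obtain ⟨b, hb⟩ := hroot _ (hgm t).1 (hgm t).2
  rw [map_evalRingHom_eval] at hb
  have hdvd : ∀ {F : O[X][X]} {x y : O}, g.evalEval x y = 0 → g ∣ F → F.evalEval x y = 0 := by
    rintro F x y h0 ⟨F', rfl⟩
    rw [evalEval_mul, h0, zero_mul]
  have hff : ∀ j, (f j).evalEval t b * (f' j).evalEval t b = h.eval t := fun j => by
    have := hdvd hb (hf j)
    rwa [evalEval_sub, evalEval_mul, evalEval_C, sub_eq_zero] at this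
  have hgY : IsUnit ((derivative g).evalEval t b) := by
    have := hdvd hb hG
    rw [evalEval_sub, evalEval_mul, evalEval_C, sub_eq_zero] at this
    exact isUnit_of_mul_isUnit_left (this ▸ hht)
  have hww := fun j => hdvd hb (hw j)
  have hfu : ∀ j, IsUnit ((f j).evalEval t b) := fun j =>
    isUnit_of_mul_isUnit_left ((hff j) ▸ hht)
  choose θ hθ using hfu
  -- the residues of the logarithmic derivatives
  let L : (J → ZMod p) → ResidueField O := fun n => ∑ j, N n j * residue O ((w j).evalEval t b)
  have hL : ∀ n, n ≠ 0 → L n ≠ 0 := by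
    intro n hn hL0
    apply hD n hn
    have h1 : (D n).eval (residue O t) = (∑ j, N n j •
        (M j).map (fun P => residue O (P.eval t))).det := by
      have := RingHom.map_det (evalRingHom (residue O t))
        (∑ j, C (N n j) • (M j).map (Polynomial.map (residue O)))
      rw [coe_evalRingHom] at this
      rw [this]
      congr 1
      ext a b
      simp [Matrix.sum_apply, eval_map_apply]
    rw [h1]
    refine Matrix.exists_mulVec_eq_zero_iff.1 ⟨fun a => residue O b ^ (a : ℕ), ?_, ?_⟩
    · intro h0
      have := congrFun h0 0
      simp at this
    · ext a
      have h2 : ∀ j, ∑ e : Fin d, residue O ((M j a e).eval t) * residue O b ^ (e : ℕ)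
          = residue O ((w j).evalEval t b) * residue O b ^ (a : ℕ) := fun j => by
        have := hdvd hb (hM j a)
        rw [evalEval_sub, evalEval_mul, evalEval_pow, evalEval_X, evalEval_finsetSum,
          sub_eq_zero] at this
        rw [← map_pow, ← map_mul, this, map_sum]
        simp [evalEval_mul, evalEval_C]
      simp only [Matrix.mulVec, dotProduct, Matrix.sum_apply, Matrix.smul_apply, Matrix.map_apply,
        smul_eq_mul, Finset.sum_mul, Pi.zero_apply]
      rw [Finset.sum_comm]
      simp only [mul_assoc, ← Finset.mul_sum, h2]
      simp only [← mul_assoc, ← Finset.sum_mul]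
      show L n * _ = 0
      rw [hL0, zero_mul]
  have hfin := finite_leading_residues hp hpm (Sum.elim θ c)
  set I := {r : ResidueField O | ∃ (k : ℕ) (n : J ⊕ ι → ℤ) (y : O),
      ((∏ i, Sum.elim θ c i ^ n i : Oˣ) : O) = 1 + (p : O) ^ (k + 2) * y ∧ residue O y = r}
    with hI
  let α := residue O ((derivative g).evalEval t b * h.eval t)
  have hα : α ≠ 0 := by
    rw [← isUnit_iff_ne_zero]
    exact (hgY.mul hht).map _
  have hbad : (⋃ n, (fun r => r * α / L n) '' I).Finite :=
    Set.finite_iUnion fun n => hfin.image _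
  obtain ⟨x', hx'⟩ := hbad.exists_notMem
  obtain ⟨x, rfl⟩ := residue_surjective x'
  have hx : ∀ n, n ≠ 0 → residue O x * L n / α ∉ I := fun n hn hmem => hx' <| by
    refine Set.mem_iUnion.2 ⟨n, _, hmem, ?_⟩
    have := hL n hn
    field_simp
  obtain ⟨z, hz⟩ := hQ t x
  set ξ := x + p * z with hξ
  have hτ : t + (p : O) ^ 2 * x + p ^ 3 * z = t + p ^ 2 * ξ := by rw [hξ]; ring
  rw [hτ] at hz
  have hξr : residue O ξ = residue O x := by simp [hξ, hres]
  have hunit : ∀ a e : O, IsUnit a → IsUnit (a + p ^ 2 * e) := by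
    intro a e ha
    rw [← isUnit_map_iff (residue O)] at ha ⊢
    simpa [hres] using ha
  -- lifting the root
  obtain ⟨η, hη⟩ : ∃ η, g.evalEval (t + p ^ 2 * ξ) (b + p ^ 2 * η) = 0 := by
    have h1 := exists_root_of_isUnit_derivative hroot ((p : O) ^ 2) b
      (g.map (evalRingHom (t + p ^ 2 * ξ))) (hgm _).1 ?_ ?_
    · simpa only [map_evalRingHom_eval] using h1
    · rw [derivative_map, map_evalRingHom_eval]
      obtain ⟨r, hr⟩ := evalEval_add_mul (derivative g) t b ξ 0 ((p : O) ^ 2)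
      rw [mul_zero, add_zero] at hr
      rw [hr, add_assoc, pow_two ((p : O) ^ 2), mul_assoc, ← mul_add]
      exact hunit _ _ hgY
    · rw [map_evalRingHom_eval]
      obtain ⟨r, hr⟩ := evalEval_add_mul g t b ξ 0 ((p : O) ^ 2)
      rw [mul_zero, add_zero, hb, zero_add] at hr
      rw [hr, pow_two ((p : O) ^ 2), mul_assoc, ← mul_add]
      exact dvd_mul_right _ _
  refine ⟨t + p ^ 2 * ξ, b + p ^ 2 * η, hz, hη, ?_, ?_⟩
  · obtain ⟨r, hr⟩ := h.binomExpansion t ((p : O) ^ 2 * ξ)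
    have h2 := hunit (h.eval t) (h.derivative.eval t * ξ + r * p ^ 2 * ξ ^ 2) hht
    rw [hr]
    convert h2 using 1
    ring
  intro a ha n m hnm
  by_contra hn0
  obtain ⟨k, n', rfl, j₀, hj₀⟩ := exists_prime_pow_smul hp n hn0
  have hrel : ∃ s, ξ * (derivX O g).evalEval t b + η * (derivative g).evalEval t b = p ^ 2 * s := by
    obtain ⟨r, hr⟩ := evalEval_add_mul g t b ξ η ((p : O) ^ 2)
    rw [hη, hb] at hr
    refine ⟨-r, mul_left_cancel₀ (pow_ne_zero 2 hp0) ?_⟩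
    linear_combination -hr
  obtain ⟨s, hs⟩ := hrel
  have hv : ∀ j, IsPrincipalUnit ((p : O) ^ 2) (a j * (θ j)⁻¹)
      (residue O x * residue O ((w j).evalEval t b) / α) := by
    intro j
    obtain ⟨r, hr⟩ := evalEval_add_mul (f j) t b ξ η ((p : O) ^ 2)
    rw [← ha, ← hθ] at hr
    have hθi : (θ j : O) * ((θ j)⁻¹ : Oˣ) = 1 := (θ j).mul_inv
    refine ⟨(ξ * (derivX O (f j)).evalEval t b + η * (derivative (f j)).evalEval t b + p ^ 2 * r)
      * ((θ j)⁻¹ : Oˣ), ?_, ?_⟩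
    · push_cast
      rw [hr]
      linear_combination hθi
    · rw [eq_div_iff hα, ← hξr]
      simp only [α, ← map_mul]
      rw [← sub_eq_zero, ← map_sub]
      have h1 := hww j
      simp only [evalEval_sub, evalEval_mul] at h1
      have h2 := hff j
      rw [← hθ] at h2
      have h3 : ∃ e, (ξ * (derivX O (f j)).evalEval t b + η * (derivative (f j)).evalEval t b
        + p ^ 2 * r) * ((θ j)⁻¹ : Oˣ) * ((derivative g).evalEval t b * h.eval t)
        - ξ * (w j).evalEval t b = p * e := by
        rw [← h2]
        refine ⟨p * (s * (derivative (f j)).evalEval t b * (f' j).evalEval t b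
          + r * (derivative g).evalEval t b * (f' j).evalEval t b), ?_⟩
        linear_combination ((ξ * (derivX O (f j)).evalEval t b
          + η * (derivative (f j)).evalEval t b + p ^ 2 * r) * (derivative g).evalEval t b
          * (f' j).evalEval t b) * hθi - ξ * h1
          + (derivative (f j)).evalEval t b * (f' j).evalEval t b * hs
      obtain ⟨e, he⟩ := h3
      rw [he, map_mul, hres, zero_mul]
  have hq : residue O ((p : O) ^ 2) = 0 := by simp [hres]
  have hV := IsPrincipalUnit.pow_prime_pow hres (IsPrincipalUnit.prod_zpow hq hv n') k
  apply hx (fun j => (n' j : ZMod p))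
  · intro h0
    exact hj₀ ((ZMod.intCast_zmod_eq_zero_iff_dvd _ _).1 (congrFun h0 j₀))
  obtain ⟨y, hy, hyr⟩ := hV
  refine ⟨k, Sum.elim (fun j => -(p ^ k * n' j)) (fun i => - m i), y, ?_, ?_⟩
  · rw [← hy]
    congr 1
    simp only [Fintype.prod_sum_type, Sum.elim_inl, Sum.elim_inr]
    simp only [Pi.smul_apply, smul_eq_mul] at hnm
    have h5 : ∏ i, c i ^ (- m i) = ∏ j, a j ^ ((p : ℤ) ^ k * n' j) := by
      simp only [zpow_neg, Finset.prod_inv_distrib]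
      exact (eq_inv_of_mul_eq_one_left hnm).symm
    rw [h5, ← Finset.prod_mul_distrib, ← Finset.prod_pow]
    refine Finset.prod_congr rfl fun j _ => ?_
    rw [← zpow_natCast, ← zpow_mul, mul_zpow, mul_comm, inv_zpow, zpow_neg]
    push_cast
    rw [mul_comm (n' j)]
  · rw [hyr, Finset.mul_sum, Finset.sum_div]
    refine Finset.sum_congr rfl fun j _ => ?_
    simp only [N, map_intCast]
    ring

theorem Int.isJacobsonRing : IsJacobsonRing ℤ := by
  rw [isJacobsonRing_iff_prime_eq]
  intro P hP
  by_cases h : P = ⊥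
  · subst h
    refine le_antisymm (fun x hx => ?_) bot_le
    rw [Ideal.mem_jacobson_bot] at hx
    have h1 := Int.isUnit_iff.1 (hx 3)
    rw [Ideal.mem_bot]
    omega
  · have := hP.isMaximal h
    exact Ideal.jacobson_eq_self_of_isMaximal

/-- A finite set of elements of a field of characteristic zero is contained in a valuation subring
whose residue field has positive characteristic. -/
theorem exists_valuationSubring_of_finite {K : Type*} [Field K] [CharZero K] (T : Set K)
    (hT : T.Finite) : ∃ (O : ValuationSubring K) (p : ℕ), T ⊆ O ∧ p.Prime ∧
      (p : O) ∈ maximalIdeal O := by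
  have := Int.isJacobsonRing
  let B := Algebra.adjoin ℤ T
  have hB : Algebra.FiniteType ℤ B := Subalgebra.fg_iff_finiteType _ |>.1
    ⟨hT.toFinset, by simp [B]⟩
  obtain ⟨m, hm⟩ := Ideal.exists_maximal B
  let := Ideal.Quotient.field m
  have hfin : Module.Finite ℤ (B ⧸ m) := finite_of_finite_type_of_isJacobsonRing ℤ (B ⧸ m)
  obtain ⟨p, hp⟩ := CharP.exists (B ⧸ m)
  have hp0 : p ≠ 0 := by
    rintro rfl
    have : CharZero (B ⧸ m) := CharP.charP_to_charZero _
    have h1 : IsField ℤ := isField_of_isIntegral_of_isField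
      (S := B ⧸ m) (RingHom.injective_int (algebraMap ℤ (B ⧸ m))) (Field.toIsField _)
    exact Int.not_isField h1
  have hpp : p.Prime := (CharP.char_is_prime_or_zero (B ⧸ m) p).resolve_right hp0
  have hpm : (p : B) ∈ m := by
    rw [← Ideal.Quotient.eq_zero_iff_mem, map_natCast]
    exact CharP.cast_eq_zero _ _
  obtain ⟨O, hO, hmO⟩ := Ideal.image_subset_nonunits_valuationSubring (A := B.toSubring) m hm.ne_top
  refine ⟨O, p, fun x hx => hO (Algebra.subset_adjoin hx), hpp, ?_⟩
  have h2 : (p : K) ∈ O.nonunits := hmO ⟨(p : B), hpm, by simp⟩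
  rw [← SetLike.mem_coe, ← ValuationSubring.image_maximalIdeal] at h2
  obtain ⟨x, hx, hxp⟩ := h2
  convert hx
  exact Subtype.ext (by simp [hxp])

theorem ValuationSubring.exists_root {K : Type*} [Field K] [IsAlgClosed K] (O : ValuationSubring K)
    (P : O[X]) (hP : P.Monic) (hd : P.natDegree ≠ 0) : ∃ x, P.eval x = 0 := by
  obtain ⟨x, hx⟩ := IsAlgClosed.exists_root (P.map (algebraMap O K)) (by
    rw [hP.degree_map]
    exact fun h => hd (natDegree_eq_of_degree_eq_some h))
  have hint : IsIntegral O x := ⟨P, hP, by rwa [IsRoot, eval_map] at hx⟩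
  obtain ⟨y, rfl⟩ := IsIntegrallyClosed.isIntegral_iff.1 hint
  refine ⟨y, ?_⟩
  rw [IsRoot, eval_map_apply] at hx
  exact (map_eq_zero_iff _ (IsFractionRing.injective O K)).1 hx

/-- The residue field of a local ring in which monic polynomials have roots is infinite. -/
theorem infinite_residueField_of_exists_root {O : Type*} [CommRing O] [IsLocalRing O]
    (hroot : ∀ P : O[X], P.Monic → P.natDegree ≠ 0 → ∃ x, P.eval x = 0) :
    Infinite (ResidueField O) := by
  by_contra hinf
  rw [not_infinite_iff_finite] at hinf
  have := Fintype.ofFinite (ResidueField O)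
  set q := Fintype.card (ResidueField O) with hq
  have hq1 : 1 < q := Fintype.one_lt_card
  have hm : (X ^ q - (X - 1) : O[X]).Monic := by
    apply monic_X_pow_sub
    rw [← C_1, degree_X_sub_C]
    exact_mod_cast hq1
  have hdeg : (X ^ q - (X - 1) : O[X]).natDegree = q := by
    apply natDegree_eq_of_degree_eq_some
    rw [degree_sub_eq_left_of_degree_lt, degree_X_pow]
    rw [degree_X_pow, ← C_1, degree_X_sub_C]
    exact_mod_cast hq1
  obtain ⟨x, hx⟩ := hroot _ hm (by omega)
  have h1 := congrArg (residue O) hx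
  simp only [eval_sub, eval_pow, eval_X, eval_one, map_sub, map_pow, map_one, map_zero] at h1
  rw [hq, FiniteField.pow_card] at h1
  simp at h1

end

section

open Polynomial

/-- An element of large degree over `F` is not a root of a nonzero polynomial of small degree
with coefficients in a finitely generated algebraic extension of `F`. -/
theorem exists_forall_natDegree_minpoly_eq {F K : Type*} [Field F] [Field K] [Algebra F K]
    [Algebra.IsAlgebraic F K] (T : Set K) (hT : T.Finite) (E : ℕ) :
    ∃ N : ℕ, N ≠ 0 ∧ ∀ z : K, (minpoly F z).natDegree = N →
      ∀ P : K[X], P ≠ 0 → P.natDegree ≤ E → (∀ i, P.coeff i ∈ Subfield.closure T) →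
        P.eval z ≠ 0 := by
  have : Finite T := hT
  let L := IntermediateField.adjoin F T
  have hLfin : FiniteDimensional F L := IntermediateField.finiteDimensional_adjoin fun x _ =>
    (Algebra.IsAlgebraic.isAlgebraic x).isIntegral
  refine ⟨Module.finrank F L * E + 1, by omega, ?_⟩
  intro z hmin P hP0 hPd hPc hPz
  have hsub : Subfield.closure T ≤ L.toSubfield :=
    Subfield.closure_le.2 (IntermediateField.subset_adjoin F T)
  have hPl : P ∈ Polynomial.lifts (algebraMap L K) :=
    (lifts_iff_coeff_lifts _).2 fun i => ⟨⟨_, hsub (hPc i)⟩, rfl⟩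
  obtain ⟨P', rfl⟩ := hPl
  rw [coe_mapRingHom] at *
  have hPz' : aeval z P' = 0 := by rwa [eval_map] at hPz
  have h0 : P' ≠ 0 := by rintro rfl; simp at hP0
  have hintF : IsIntegral F z := (Algebra.IsAlgebraic.isAlgebraic z).isIntegral
  have hint : IsIntegral L z := hintF.tower_top
  have h3 : (minpoly L z).natDegree ≤ E := by
    refine le_trans (natDegree_le_of_dvd (minpoly.dvd _ _ hPz') h0) ?_
    rwa [natDegree_map] at hPd
  let L' := IntermediateField.adjoin L {z}
  have h4 : Module.finrank L L' = (minpoly L z).natDegree :=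
    IntermediateField.adjoin.finrank hint
  have : FiniteDimensional L L' := IntermediateField.adjoin.finiteDimensional hint
  have : FiniteDimensional F L' := Module.Finite.trans L L'
  have h5 : Module.finrank F L * Module.finrank L L' = Module.finrank F L' :=
    Module.finrank_mul_finrank F L L'
  have : IsScalarTower F L' K := IsScalarTower.of_algebraMap_eq fun x => rfl
  have h6 := minpoly.natDegree_le (A := F) (IntermediateField.AdjoinSimple.gen L z)
  have h7 : minpoly F (IntermediateField.AdjoinSimple.gen L z) = minpoly F z := by
    have := minpoly.algebraMap_eq (A := F) (algebraMap L' K).injective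
      (IntermediateField.AdjoinSimple.gen L z)
    rw [← this]; simp
  have h6' : (minpoly F z).natDegree ≤ Module.finrank F L * (minpoly L z).natDegree := by
    rw [← h7, ← h4, h5]; exact h6
  have h8 := Nat.mul_le_mul_left (Module.finrank F L) h3
  omega

theorem irreducible_X_pow_sub_C_of_prime {A : Type*} [CommRing A] [IsDomain A] {a : A}
    (ha : Prime a) {N : ℕ} (hN : N ≠ 0) : Irreducible (X ^ N - C a) := by
  have hmon : (X ^ N - C a).Monic := monic_X_pow_sub_C _ hN
  have hdeg : (X ^ N - C a).degree = (N : WithBot ℕ) := degree_X_pow_sub_C (Nat.pos_of_ne_zero hN) _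
  refine irreducible_of_eisenstein_criterion
    ((Ideal.span_singleton_prime ha.ne_zero).2 ha) ?_ ?_ ?_ ?_ hmon.isPrimitive
  · rw [hmon.leadingCoeff, Ideal.mem_span_singleton]
    exact fun h => ha.not_isUnit (isUnit_of_dvd_one h)
  · intro n hn
    rw [hdeg, Nat.cast_lt] at hn
    rw [coeff_sub, coeff_X_pow, if_neg hn.ne, zero_sub, coeff_C, Ideal.mem_span_singleton]
    split_ifs <;> simp
  · rw [hdeg]; exact_mod_cast Nat.pos_of_ne_zero hN
  · rw [coeff_sub, coeff_X_pow, if_neg hN.symm, zero_sub, coeff_C_zero,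
      Ideal.span_singleton_pow, Ideal.mem_span_singleton, dvd_neg]
    rintro ⟨b, hb⟩
    have h1 : a * 1 = a * (a * b) := by linear_combination hb
    exact ha.not_isUnit (isUnit_of_dvd_one ⟨b, mul_left_cancel₀ ha.ne_zero h1⟩)

theorem natDegree_minpoly_of_pow_eq_prime {A F K : Type*} [CommRing A] [IsDomain A]
    [IsIntegrallyClosed A] [Field F] [Algebra A F] [IsFractionRing A F] [Field K] [Algebra F K]
    [Algebra A K] [IsScalarTower A F K] {a : A} (ha : Prime a) {N : ℕ} (hN : N ≠ 0) {z : K}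
    (hz : z ^ N = algebraMap A K a) : (minpoly F z).natDegree = N := by
  have hmon : (X ^ N - C a).Monic := monic_X_pow_sub_C _ hN
  have hirrF : Irreducible ((X ^ N - C a).map (algebraMap A F)) :=
    (hmon.irreducible_iff_irreducible_map_fraction_map).1 (irreducible_X_pow_sub_C_of_prime ha hN)
  rw [← minpoly.eq_of_irreducible_of_monic hirrF (by simp [hz, ← IsScalarTower.algebraMap_apply])
    (hmon.map _), hmon.natDegree_map, natDegree_X_pow_sub_C]

/-- An algebraically closed field of characteristic zero contains, for every finite set
`T` and every bound `E`, an algebraic integer of degree `> E` over the subfield generated by `T`. -/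
theorem exists_isIntegral_of_large_degree {K : Type*} [Field K] [CharZero K] [IsAlgClosed K]
    (T : Set K) (hT : T.Finite) (E : ℕ) : ∃ z : K, IsIntegral ℤ z ∧
      ∀ P : K[X], P ≠ 0 → P.natDegree ≤ E → (∀ i, P.coeff i ∈ Subfield.closure T) →
        P.eval z ≠ 0 := by
  obtain ⟨s, hs⟩ := exists_isTranscendenceBasis ℤ K
  let A := Algebra.adjoin ℤ (Set.range ((↑) : s → K))
  let e : MvPolynomial s ℤ ≃ₐ[ℤ] A := hs.1.aevalEquiv
  have hUFD : UniqueFactorizationMonoid A := e.toMulEquiv.uniqueFactorizationMonoid inferInstance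
  have h2 : Prime (2 : A) := by
    have h : Prime (MvPolynomial.C 2 : MvPolynomial s ℤ) :=
      (MvPolynomial.prime_C_iff s).2 Int.prime_two
    have h' := (MulEquiv.prime_iff e.toMulEquiv).2 h
    convert h'
    have : (MvPolynomial.C 2 : MvPolynomial s ℤ) = 2 := rfl
    rw [this]
    exact (map_ofNat e 2).symm
  have halg : Algebra.IsAlgebraic A K := hs.isAlgebraic
  let : Algebra (FractionRing A) K := FractionRing.liftAlgebra A K
  have hFK : Algebra.IsAlgebraic (FractionRing A) K :=
    (IsFractionRing.comap_isAlgebraic_iff (A := A) (K := FractionRing A) (C := K)).1 halg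
  obtain ⟨N, hN, hmain⟩ := exists_forall_natDegree_minpoly_eq (F := FractionRing A) T hT E
  obtain ⟨z, hz⟩ := IsAlgClosed.exists_pow_nat_eq (2 : K) (Nat.pos_of_ne_zero hN)
  have hzA : z ^ N = algebraMap A K 2 := by rw [hz, map_ofNat]
  exact ⟨z, ⟨X ^ N - C 2, monic_X_pow_sub_C _ hN, by simp [hz]⟩,
    hmain z (natDegree_minpoly_of_pow_eq_prime h2 hN hzA)⟩

section Pencil

variable {J : Type*} [Fintype J] {R S : Type*} [CommRing R] [CommRing S] {d : ℕ}

/-- The determinant of the generic linear combination of a family of polynomial matrices. -/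
noncomputable def pencilDet (M : J → Matrix (Fin d) (Fin d) R[X]) : (MvPolynomial J R)[X] :=
  (∑ j, (C (MvPolynomial.X j) : (MvPolynomial J R)[X]) •
    (M j).map (Polynomial.map MvPolynomial.C)).det

theorem map_pencilDet {A B : Type*} [CommRing A] [CommRing B] (x : J → A) (ψ : A →+* B)
    (N : J → Matrix (Fin d) (Fin d) A[X]) :
    Polynomial.map ψ (∑ j, C (x j) • N j).det =
      (∑ j, C (ψ (x j)) • (N j).map (Polynomial.map ψ)).det := by
  rw [← coe_mapRingHom, RingHom.map_det]
  congr 1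
  ext1 a b
  simp [Matrix.sum_apply]

theorem pencilDet_map_eval₂Hom (M : J → Matrix (Fin d) (Fin d) R[X]) (ρ : R →+* S) (e : J → S) :
    (pencilDet M).map (MvPolynomial.eval₂Hom ρ e) =
      (∑ j, C (e j) • (M j).map (Polynomial.map ρ)).det := by
  rw [pencilDet, map_pencilDet]
  congr 2
  ext1 j
  rw [MvPolynomial.coe_eval₂Hom, MvPolynomial.eval₂_X]
  congr 1
  ext1 a b
  have h : (MvPolynomial.eval₂Hom ρ e).comp MvPolynomial.C = ρ :=
    RingHom.ext fun r => MvPolynomial.eval₂_C ρ e r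
  simp only [Matrix.map_apply, Polynomial.map_map, h]

theorem pencilDet_map_map (M : J → Matrix (Fin d) (Fin d) R[X]) (ρ : R →+* S) :
    (pencilDet M).map (MvPolynomial.map ρ) = pencilDet fun j => (M j).map (Polynomial.map ρ) := by
  have h : (MvPolynomial.map (σ := J) ρ).comp MvPolynomial.C = MvPolynomial.C.comp ρ :=
    RingHom.ext fun r => MvPolynomial.map_C ρ r
  have h2 : ∀ j, ((M j).map (Polynomial.map MvPolynomial.C)).map
      (Polynomial.map (MvPolynomial.map (σ := J) ρ)) =
      ((M j).map (Polynomial.map ρ)).map (Polynomial.map MvPolynomial.C) := fun j => by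
    ext1 a b
    simp only [Matrix.map_apply, Polynomial.map_map, h]
  refine (map_pencilDet _ _ _).trans ?_
  simp only [h2, MvPolynomial.map_X]
  rfl

theorem exists_X_pow_mem_span_pencilDet {K : Type*} [Field K] [IsAlgClosed K]
    (M : J → Matrix (Fin d) (Fin d) K[X])
    (hdet : ∀ e : J → K, e ≠ 0 → (∑ j, C (e j) • M j).det ≠ 0) (j : J) :
    ∃ N : ℕ, (MvPolynomial.X j : MvPolynomial J K) ^ N ∈ Ideal.span (Set.range (pencilDet M).coeff) := by
  change MvPolynomial.X j ∈ Ideal.radical _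
  rw [← MvPolynomial.vanishingIdeal_zeroLocus_eq_radical (K := K)]
  intro e he
  rw [MvPolynomial.aeval_X]
  suffices e = 0 by simp [this]
  by_contra hne
  refine hdet e hne ?_
  have h1 := pencilDet_map_eval₂Hom M (RingHom.id K) e
  have h2 : ∀ j, (M j).map (Polynomial.map (RingHom.id K)) = M j := fun j => by
    ext1 a b
    rw [Matrix.map_apply, Polynomial.map_id]
  simp only [h2] at h1
  rw [← h1]
  ext n
  rw [coeff_map, coeff_zero]
  have := he _ (Ideal.subset_span ⟨n, rfl⟩)
  rwa [MvPolynomial.aeval_def] at this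

theorem det_ne_zero_of_X_pow_mem_span_pencilDet {κ : Type*} [Field κ]
    (M : J → Matrix (Fin d) (Fin d) R[X])
    (h : ∀ j, ∃ N : ℕ, (MvPolynomial.X j : MvPolynomial J R) ^ N ∈
      Ideal.span (Set.range (pencilDet M).coeff)) (ρ : R →+* κ) (e : J → κ) (he : e ≠ 0) :
    (∑ j, C (e j) • (M j).map (Polynomial.map ρ)).det ≠ 0 := by
  intro h0
  rw [← pencilDet_map_eval₂Hom] at h0
  apply he
  ext1 j
  obtain ⟨N, hN⟩ := h j
  have h1 : Ideal.span (Set.range (pencilDet M).coeff) ≤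
      RingHom.ker (MvPolynomial.eval₂Hom ρ e) := by
    rw [Ideal.span_le]
    rintro _ ⟨n, rfl⟩
    have := congrArg (coeff · n) h0
    simp only [coeff_map, coeff_zero] at this
    exact this
  have h2 := h1 hN
  rw [RingHom.mem_ker, map_pow] at h2
  have h3 := eq_zero_of_pow_eq_zero h2
  simpa using h3

omit [Fintype J] in
theorem exists_finite_forall_X_pow_mem_span.{u} {K : Type u} [Field K] (P : (MvPolynomial J K)[X])
    {x : MvPolynomial J K} (hx : x ∈ Ideal.span (Set.range P.coeff)) :
    ∃ T : Set K, T.Finite ∧ ∀ (S : Type u) [CommRing S] (σ : S →+* K),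
      Function.Injective σ → T ⊆ Set.range σ → ∀ (P' : (MvPolynomial J S)[X]) (x' : MvPolynomial J S), P'.map (MvPolynomial.map σ) = P →
      MvPolynomial.map σ x' = x → x' ∈ Ideal.span (Set.range P'.coeff) := by
  obtain ⟨c, hc⟩ := Finsupp.mem_ideal_span_range_iff_exists_finsupp.1 hx
  refine ⟨⋃ l ∈ c.support, (c l).coeffs, ?_, ?_⟩
  · exact c.support.finite_toSet.biUnion fun l _ => Finset.finite_toSet _
  · intro S _ σ hσ hO P' x' hP' hx'
    have h1 : ∀ l, ∃ y : MvPolynomial J S, MvPolynomial.map σ y = c l := by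
      intro l
      change c l ∈ Set.range (MvPolynomial.map σ : MvPolynomial J S →+* _)
      rw [MvPolynomial.mem_range_map_iff_coeffs_subset]
      intro r hr
      have hl : l ∈ c.support := by
        rw [Finsupp.mem_support_iff]
        intro h; simp [h] at hr
      exact hO (Set.mem_biUnion (t := fun l => ((c l).coeffs : Set K)) hl hr)
    choose c' hc' using h1
    have h2 : x' = ∑ l ∈ c.support, c' l * P'.coeff l := by
      apply MvPolynomial.map_injective σ hσ
      rw [hx', map_sum, ← hc, Finsupp.sum]
      refine Finset.sum_congr rfl fun l _ => ?_
      rw [map_mul, hc', ← hP', coeff_map]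
    rw [h2]
    exact Ideal.sum_mem _ fun l _ => Ideal.mul_mem_left _ _ (Ideal.subset_span ⟨l, rfl⟩)

end Pencil

end

section

open Polynomial IsLocalRing

section Lift

variable {K O : Type*} [Field K] [CommRing O]

/-- The set of all scalars occurring in a bivariate polynomial. -/
def scalars (F : K[X][X]) : Set K := ⋃ P ∈ Set.range F.coeff, Set.range P.coeff

theorem finite_scalars (F : K[X][X]) : (scalars F).Finite :=
  F.finite_range_coeff.biUnion fun P _ => P.finite_range_coeff

theorem exists_map_eq_of_range_coeff_subset (σ : O →+* K) {P : K[X]}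
    (h : Set.range P.coeff ⊆ Set.range σ) : ∃ P' : O[X], P'.map σ = P :=
  (lifts_iff_coeff_lifts (f := σ) P).2 fun n => h ⟨n, rfl⟩

theorem exists_map_eq_of_scalars_subset (σ : O →+* K) {F : K[X][X]}
    (h : scalars F ⊆ Set.range σ) : ∃ F' : O[X][X], F'.map (mapRingHom σ) = F :=
  (lifts_iff_coeff_lifts (f := mapRingHom σ) F).2 fun n =>
    exists_map_eq_of_range_coeff_subset σ
      ((Set.subset_biUnion_of_mem (u := fun P : K[X] => Set.range P.coeff)
        (Set.mem_range_self n)).trans h)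

end Lift

theorem exists_specialization_of_isAlgClosed {K : Type*} [Field K] [CharZero K] [IsAlgClosed K]
    {J ι : Type*} [Fintype J] [Fintype ι]
    (g : K[X][X]) (hg : g.Monic) (hgd : g.natDegree ≠ 0) (h : K[X]) (hh : h ≠ 0)
    (f f' w : J → K[X][X]) (G : K[X][X])
    (hf : ∀ j, g ∣ f j * f' j - C h) (hG : g ∣ derivative g * G - C h)
    (hw : ∀ j, g ∣ w j - (derivative g * derivX K (f j) - derivX K g * derivative (f j)) * f' j)
    {d : ℕ} [NeZero d] (M : J → Matrix (Fin d) (Fin d) K[X])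
    (hM : ∀ j (a : Fin d), g ∣ w j * X ^ (a : ℕ) - ∑ b : Fin d, C (M j a b) * X ^ (b : ℕ))
    (hdet : ∀ e : J → K, e ≠ 0 → (∑ j, C (e j) • M j).det ≠ 0)
    (c : ι → Kˣ) (T₀ : Set K) (hT₀ : T₀.Finite) (E : ℕ) :
    ∃ τ b : K, (∀ P : K[X], P ≠ 0 → P.natDegree ≤ E → (∀ i, P.coeff i ∈ Subfield.closure T₀) →
        P.eval τ ≠ 0) ∧ g.evalEval τ b = 0 ∧ h.eval τ ≠ 0 ∧
      ∀ a : J → Kˣ, (∀ j, (a j : K) = (f j).evalEval τ b) →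
        ∀ (n : J → ℤ) (m : ι → ℤ), (∏ j, a j ^ n j) * ∏ i, c i ^ m i = 1 → n = 0 := by
  have hnull := fun j => exists_X_pow_mem_span_pencilDet M hdet j
  choose N hN using hnull
  choose S hSfin hS using fun j => exists_finite_forall_X_pow_mem_span (pencilDet M) (hN j)
  let T : Set K := scalars g ∪ scalars G ∪ Set.range h.coeff ∪ {h.leadingCoeff⁻¹} ∪
    (⋃ j, (scalars (f j) ∪ scalars (f' j) ∪ scalars (w j) ∪ S j ∪
      ⋃ a, ⋃ b, Set.range (M j a b).coeff)) ∪ ⋃ i, {(c i : K), (c i : K)⁻¹}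
  have hT : T.Finite := by
    refine Set.Finite.union (Set.Finite.union (Set.Finite.union (Set.Finite.union (Set.Finite.union
      (finite_scalars g) (finite_scalars G)) h.finite_range_coeff) (Set.finite_singleton _)) ?_) ?_
    · refine Set.finite_iUnion fun j => ?_
      refine Set.Finite.union (Set.Finite.union (Set.Finite.union (Set.Finite.union
        (finite_scalars _) (finite_scalars _)) (finite_scalars _)) (hSfin j)) ?_
      exact Set.finite_iUnion fun a => Set.finite_iUnion fun b => (M j a b).finite_range_coeff
    · exact Set.finite_iUnion fun i => Set.toFinite _
  obtain ⟨O, p, hTO, hp, hpm⟩ := exists_valuationSubring_of_finite T hT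
  have hT' : T ⊆ Set.range O.subtype := fun x hx => ⟨⟨x, hTO hx⟩, rfl⟩
  simp only [T, Set.union_subset_iff, Set.iUnion_subset_iff] at hT'
  obtain ⟨⟨⟨⟨⟨hg1, hG1⟩, hh1⟩, hlc⟩, hJ⟩, hc1⟩ := hT'
  have hinj : Function.Injective O.subtype := Subtype.val_injective
  have hinj2 : Function.Injective (mapRingHom O.subtype) := map_injective _ hinj
  obtain ⟨g, rfl⟩ := exists_map_eq_of_scalars_subset _ hg1
  obtain ⟨G, rfl⟩ := exists_map_eq_of_scalars_subset _ hG1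
  obtain ⟨h, rfl⟩ := exists_map_eq_of_range_coeff_subset _ hh1
  choose f₁ hf₁ using fun j => exists_map_eq_of_scalars_subset _ (hJ j).1.1.1.1
  choose f₁' hf₁' using fun j => exists_map_eq_of_scalars_subset _ (hJ j).1.1.1.2
  choose w₁ hw₁ using fun j => exists_map_eq_of_scalars_subset _ (hJ j).1.1.2
  have hM₀ : ∀ j, ∃ N : Matrix (Fin d) (Fin d) O[X], N.map (Polynomial.map O.subtype) = M j := by
    intro j
    choose N hN using fun a b => exists_map_eq_of_range_coeff_subset _ ((hJ j).2 a b)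
    exact ⟨N, Matrix.ext hN⟩
  choose M₁ hM₁ using hM₀
  obtain rfl : (fun j => (f₁ j).map (mapRingHom O.subtype)) = f := funext hf₁
  obtain rfl : (fun j => (f₁' j).map (mapRingHom O.subtype)) = f' := funext hf₁'
  obtain rfl : (fun j => (w₁ j).map (mapRingHom O.subtype)) = w := funext hw₁
  obtain rfl : (fun j => (M₁ j).map (Polynomial.map O.subtype)) = M := funext hM₁
  have hgm : g.Monic := hinj2.monic_map_iff.2 hg
  have hdvd : ∀ F : O[X][X], g.map (mapRingHom O.subtype) ∣ F.map (mapRingHom O.subtype) → g ∣ F :=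
    fun F hF => (map_dvd_map _ hinj2 hgm).1 hF
  choose c₁ hc₁ using fun i => hc1 i (Set.mem_insert _ _)
  choose c₂ hc₂ using fun i => hc1 i (Set.mem_insert_of_mem _ rfl)
  have hc12 : ∀ i, c₁ i * c₂ i = 1 := fun i => hinj (by
    rw [map_mul, hc₁, hc₂, map_one]; exact mul_inv_cancel₀ (c i).ne_zero)
  let u : ι → Oˣ := fun i => ⟨c₁ i, c₂ i, hc12 i, by rw [mul_comm, hc12]⟩
  have hhres : h.map (residue O) ≠ 0 := by
    intro h0
    obtain ⟨l, hl⟩ := hlc rfl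
    have h1 : h.leadingCoeff * l = 1 := hinj (by
      rw [map_mul, hl, leadingCoeff_map_of_injective hinj, map_one]
      refine mul_inv_cancel₀ ?_
      rw [← leadingCoeff_map_of_injective hinj, Ne, leadingCoeff_eq_zero]
      exact hh)
    have h2 := congrArg (residue O) h1
    have h3 : residue O h.leadingCoeff = 0 := by
      have := congrArg (coeff · h.natDegree) h0
      simp only [coeff_map, coeff_zero] at this
      exact this
    rw [map_mul, h3, zero_mul, map_one] at h2
    exact zero_ne_one h2
  have : Infinite (ResidueField O) :=
    infinite_residueField_of_exists_root (O.exists_root)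
  have hspan : ∀ j, ∃ N : ℕ, (MvPolynomial.X j : MvPolynomial J O) ^ N ∈
      Ideal.span (Set.range (pencilDet M₁).coeff) := fun j => ⟨N j,
    hS j O O.subtype hinj ((hJ j).1.2) _ _ (pencilDet_map_map _ _)
      (by rw [map_pow, MvPolynomial.map_X])⟩
  have hf₂ : ∀ j, g ∣ f₁ j * f₁' j - C h := fun j => hdvd _ (by
    simpa only [Polynomial.map_sub, Polynomial.map_mul, Polynomial.map_C,
      coe_mapRingHom] using hf j)
  have hG₂ : g ∣ derivative g * G - C h := hdvd _ (by
    simpa only [Polynomial.map_sub, Polynomial.map_mul, Polynomial.map_C, derivative_map,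
      coe_mapRingHom] using hG)
  have hw₂ : ∀ j, g ∣ w₁ j - (derivative g * derivX O (f₁ j) - derivX O g * derivative (f₁ j)) *
      f₁' j := fun j => hdvd _ (by
    simpa only [Polynomial.map_sub, Polynomial.map_mul, Polynomial.map_C, derivative_map,
      derivX_map] using hw j)
  have hM₂ : ∀ j (a : Fin d), g ∣ w₁ j * X ^ (a : ℕ) - ∑ b : Fin d, C (M₁ j a b) * X ^ (b : ℕ) :=
    fun j a => hdvd _ (by
      simpa only [Polynomial.map_sub, Polynomial.map_mul, Polynomial.map_C, Polynomial.map_pow,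
        Polynomial.map_X, Polynomial.map_sum, Matrix.map_apply, coe_mapRingHom] using hM j a)
  have hlarge : ∀ t x : O, ∃ z : O, ∀ P : K[X], P ≠ 0 → P.natDegree ≤ E →
      (∀ i, P.coeff i ∈ Subfield.closure T₀) →
        P.eval ((t + p ^ 2 * x + p ^ 3 * z : O) : K) ≠ 0 := by
    intro t x
    obtain ⟨z, hz, hz'⟩ := exists_isIntegral_of_large_degree (T₀ ∪ {(t : K), (x : K)})
      (hT₀.union (Set.toFinite _)) E
    obtain ⟨y, rfl⟩ := IsIntegrallyClosed.isIntegral_iff.1 (hz.tower_top (A := O))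
    refine ⟨y, fun P hP0 hPd hPc => ?_⟩
    set L := Subfield.closure (T₀ ∪ {(t : K), (x : K)})
    have htL : (t : K) ∈ L := Subfield.subset_closure (by simp)
    have hxL : (x : K) ∈ L := Subfield.subset_closure (by simp)
    have hTL : Subfield.closure T₀ ≤ L := Subfield.closure_mono Set.subset_union_left
    have hp0 : (p : K) ^ 3 ≠ 0 := pow_ne_zero _ (by exact_mod_cast hp.ne_zero)
    have hpL : (p : K) ∈ L := natCast_mem L p
    let ℓ : K[X] := C ((p : K) ^ 3) * X + C ((t : K) + p ^ 2 * x)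
    have hℓ : ℓ.natDegree = 1 := natDegree_linear hp0
    have hcomp : P.comp ℓ ≠ 0 := by
      intro h0
      rcases comp_eq_zero_iff.1 h0 with h1 | ⟨-, h1⟩
      · exact hP0 h1
      · rw [h1, natDegree_C] at hℓ
        exact zero_ne_one hℓ
    have hcoef : ∀ i, (P.comp ℓ).coeff i ∈ L := by
      have hPl : P ∈ Polynomial.lifts L.subtype :=
        (lifts_iff_coeff_lifts _).2 fun i => ⟨⟨_, hTL (hPc i)⟩, rfl⟩
      obtain ⟨P', rfl⟩ := hPl
      let ℓ' : L[X] := C (⟨p, hpL⟩ ^ 3) * X + C (⟨t, htL⟩ + ⟨p, hpL⟩ ^ 2 * ⟨x, hxL⟩)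
      have hℓ' : ℓ'.map L.subtype = ℓ := by simp [ℓ', ℓ]
      intro i
      rw [coe_mapRingHom, ← hℓ', ← map_comp, coeff_map]
      exact Subtype.mem _
    have := hz' (P.comp ℓ) hcomp (by rw [natDegree_comp, hℓ, mul_one]; exact hPd) hcoef
    have hval : eval (algebraMap O K y) ℓ = ((t + p ^ 2 * x + p ^ 3 * y : O) : K) := by
      simp only [ℓ, eval_add, eval_mul, eval_C, eval_X]
      push_cast
      change (p : K) ^ 3 * (y : K) + _ = _
      ring
    rwa [eval_comp, hval] at this
  obtain ⟨τ, b, hQ, hτb, hu, hmain⟩ := exists_specialization_of_localRing O.exists_root hp hpm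
    g hgm (by rwa [natDegree_map_eq_of_injective hinj2] at hgd) h f₁ f₁' w₁ G hf₂ hG₂ hw₂ M₁ hM₂
    hhres (fun n hn => det_ne_zero_of_X_pow_mem_span_pencilDet M₁ hspan _ n hn) u
    (fun x => ∀ P : K[X], P ≠ 0 → P.natDegree ≤ E → (∀ i, P.coeff i ∈ Subfield.closure T₀) →
        P.eval (x : K) ≠ 0) hlarge
  have hff : ∀ j, (f₁ j).evalEval τ b * (f₁' j).evalEval τ b = h.eval τ := fun j => by
    obtain ⟨q, hq⟩ := hf₂ j
    have := congrArg (evalEval τ b) hq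
    rw [evalEval_mul, hτb, zero_mul, evalEval_sub, evalEval_mul, evalEval_C, sub_eq_zero] at this
    exact this
  refine ⟨τ, b, hQ, ?_, ?_, ?_⟩
  · have := map_mapRingHom_evalEval O.subtype g τ b
    rw [hτb, map_zero] at this
    exact this
  · have := (hu.map O.subtype).ne_zero
    rwa [← eval_map_apply] at this
  · intro a ha n m hrel
    have hunit : ∀ j, IsUnit ((f₁ j).evalEval τ b) := fun j =>
      isUnit_of_mul_isUnit_left (y := (f₁' j).evalEval τ b) (by rw [hff]; exact hu)
    refine hmain (fun j => (hunit j).unit) (fun j => (hunit j).unit_spec) n m ?_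
    have hUinj : Function.Injective (Units.map (O.subtype : O →* K)) := Units.map_injective hinj
    apply hUinj
    rw [map_mul, map_prod, map_prod, map_one, ← hrel]
    congr 1
    · refine Finset.prod_congr rfl fun j _ => ?_
      rw [map_zpow]
      congr 1
      ext
      rw [ha j]
      exact (map_mapRingHom_evalEval O.subtype (f₁ j) τ b).symm
    · refine Finset.prod_congr rfl fun i _ => ?_
      rw [map_zpow]
      congr 1
      ext
      exact hc₁ i

end

section

open Polynomial

section DVR

variable {K V F : Type*} [Field K] [CommRing V] [IsDomain V] [IsDiscreteValuationRing V] [Field F]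
  [Algebra V F] [IsFractionRing V F] [Algebra K V] [Algebra K F] [IsScalarTower K V F]

omit [IsFractionRing V F] in
/-- A derivation of a valued field with bounded poles preserves the valuation ring as soon as it
maps a uniformizer to a unit. -/
theorem IsDiscreteValuationRing.derivation_apply_mem_range
    (hres : ∀ x : V, ∃ c : K, x - algebraMap K V c ∈ IsLocalRing.maximalIdeal V) (D : Derivation K F F)
    {u : V} (hu : Irreducible u) (hDu : D (algebraMap V F u) = 1) (N : ℕ)
    (hN : ∀ x : V, algebraMap V F u ^ N * D (algebraMap V F x) ∈ (algebraMap V F).range) (x : V) :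
    D (algebraMap V F x) ∈ (algebraMap V F).range := by
  induction N generalizing x with
  | zero => simpa using hN x
  | succ N ih =>
    refine ih (fun x => ?_) x
    obtain ⟨c, hc⟩ := hres x
    rw [hu.maximalIdeal_eq, Ideal.mem_span_singleton] at hc
    obtain ⟨x', hx'⟩ := hc
    have hx : algebraMap V F x = algebraMap K F c + algebraMap V F u * algebraMap V F x' := by
      rw [← map_mul, ← hx', map_sub, ← IsScalarTower.algebraMap_apply]; ring
    rw [hx, map_add, D.map_algebraMap, zero_add, D.leibniz, hDu, smul_eq_mul, smul_eq_mul, mul_one,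
      mul_add, ← mul_assoc, ← pow_succ]
    exact Subring.add_mem _ (hN x') ⟨u ^ N * x', by simp⟩

/-- The residue theorem at a single place: a linear relation between logarithmic differentials
implies the same relation between the orders. -/
theorem IsDiscreteValuationRing.sum_mul_order_eq_zero
    (hres : ∀ x : V, ∃ c : K, x - algebraMap K V c ∈ IsLocalRing.maximalIdeal V) (D : Derivation K F F)
    (hD : ∀ x, D x = 0 → x ∈ (algebraMap K F).range) {δ : V} (hδ : δ ≠ 0)
    (hDδ : ∀ x : V, algebraMap V F δ * D (algebraMap V F x) ∈ (algebraMap V F).range)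
    {u : V} (hu : Irreducible u) {J : Type*} [Fintype J] (a : J → F) (n : J → ℤ) (y : J → Vˣ)
    (ha : ∀ j, a j = algebraMap V F u ^ n j * algebraMap V F (y j)) (e : J → K)
    (he : ∑ j, e j • (D (a j) / a j) = 0) : ∑ j, e j * (n j : K) = 0 := by
  have hinj := IsFractionRing.injective V F
  set U := algebraMap V F u with hU
  have hU0 : U ≠ 0 := by rw [hU, Ne, map_eq_zero_iff _ hinj]; exact hu.ne_zero
  have hUK : U ∉ (algebraMap K F).range := by
    rintro ⟨c, hc⟩
    rw [IsScalarTower.algebraMap_apply K V F] at hc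
    have h1 : algebraMap K V c = u := hinj hc
    have hc0 : c ≠ 0 := by rintro rfl; exact hu.ne_zero (by simpa using h1.symm)
    exact hu.not_isUnit (h1 ▸ (IsUnit.mk0 c hc0).map (algebraMap K V))
  have hDU : D U ≠ 0 := fun h => hUK (hD _ h)
  let D' : Derivation K F F := (D U)⁻¹ • D
  have hD'U : D' U = 1 := inv_mul_cancel₀ hDU
  have hbound : ∃ N : ℕ, ∀ x : V, U ^ N * D' (algebraMap V F x) ∈ (algebraMap V F).range := by
    obtain ⟨b, s, hs, hbs⟩ := IsFractionRing.div_surjective (A := V) (D U)⁻¹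
    have hs0 : s ≠ 0 := nonZeroDivisors.ne_zero hs
    obtain ⟨N, v, hv⟩ := IsDiscreteValuationRing.eq_unit_mul_pow_irreducible
      (mul_ne_zero hδ hs0) hu
    refine ⟨N, fun x => ?_⟩
    obtain ⟨z, hz⟩ := hDδ x
    refine ⟨(↑v⁻¹ : V) * b * z, ?_⟩
    have h1 : u ^ N = (↑v⁻¹ : V) * (δ * s) := by rw [hv, Units.inv_mul_cancel_left]
    have hs1 : algebraMap V F s ≠ 0 := by rwa [Ne, map_eq_zero_iff _ hinj]
    change _ = U ^ N * ((D U)⁻¹ * D (algebraMap V F x))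
    rw [hU, ← map_pow, h1, ← hbs]
    simp only [map_mul]
    rw [hz]
    field_simp
  obtain ⟨N, hN⟩ := hbound
  have hV := IsDiscreteValuationRing.derivation_apply_mem_range hres D' hu hD'U N hN
  have hlog : ∀ j, ∃ z : V, D' (a j) / a j = n j * U⁻¹ + algebraMap V F z := by
    intro j
    obtain ⟨z, hz⟩ := hV (y j)
    have hy0 : algebraMap V F (y j) ≠ 0 := by
      rw [Ne, map_eq_zero_iff _ hinj]; exact (y j).ne_zero
    have hyinv : algebraMap V F (↑(y j)⁻¹ : V) = (algebraMap V F (y j))⁻¹ := by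
      refine eq_inv_of_mul_eq_one_right ?_
      rw [← map_mul, Units.mul_inv, map_one]
    refine ⟨z * (↑(y j)⁻¹ : V), ?_⟩
    rw [ha, D'.leibniz, map_mul, hz, hyinv, D'.leibniz_zpow, hD'U, zpow_sub_one₀ hU0]
    have hUn : U ^ n j ≠ 0 := zpow_ne_zero _ hU0
    simp only [smul_eq_mul, zsmul_eq_mul]
    field_simp
    ring
  choose z hz using hlog
  have he' : ∑ j, e j • (D' (a j) / a j) = 0 := by
    have := congrArg ((D U)⁻¹ * ·) he
    simp only [mul_zero, Finset.mul_sum] at this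
    rw [← this]
    refine Finset.sum_congr rfl fun j _ => ?_
    change e j • ((D U)⁻¹ * D (a j) / a j) = _
    rw [mul_smul_comm, mul_div_assoc]
  by_contra hne
  have h1 : algebraMap K F (∑ j, e j * (n j : K)) * U⁻¹ =
      algebraMap V F (-∑ j, algebraMap K V (e j) * z j) := by
    simp only [hz, Algebra.smul_def] at he'
    simp only [map_sum, map_mul, map_neg, map_intCast, ← IsScalarTower.algebraMap_apply,
      Finset.sum_mul]
    rw [eq_neg_iff_add_eq_zero, ← Finset.sum_add_distrib, ← he']
    exact Finset.sum_congr rfl fun j _ => by ring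
  refine hu.not_isUnit (isUnit_of_mul_isUnit_left
    (y := -∑ j, algebraMap K V (e j) * z j) ?_)
  have h2 : u * (-∑ j, algebraMap K V (e j) * z j) = algebraMap K V (∑ j, e j * (n j : K)) := by
    apply hinj
    rw [map_mul, ← h1, ← IsScalarTower.algebraMap_apply]
    change U * _ = _
    field_simp
  rw [h2]
  exact (IsUnit.mk0 _ hne).map (algebraMap K V)

end DVR

section

variable {K F : Type*} [Field K] [Field F] [Algebra K F] [Algebra K[X] F] [IsScalarTower K K[X] F]

theorem Derivation.map_algebraMap_polynomial (D : Derivation K F F) (p : K[X]) :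
    D (algebraMap K[X] F p) = algebraMap K[X] F (derivative p) * D (algebraMap K[X] F X) := by
  have h : ∀ q : K[X], algebraMap K[X] F q = aeval (algebraMap K[X] F X) q := fun q => by
    have : IsScalarTower.toAlgHom K K[X] F = aeval (algebraMap K[X] F X) :=
      Polynomial.algHom_ext (by simp)
    exact DFunLike.congr_fun this q
  rw [h p, h (derivative p), Derivation.map_aeval, smul_eq_mul]

theorem exists_mul_derivation_mem_integralClosure [FaithfulSMul K[X] F]
    [Module.Finite K[X] (integralClosure K[X] F)] [Algebra.IsAlgebraic K[X] F]
    (D : Derivation K F F) (hD : D (algebraMap K[X] F X) = 1) :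
    ∃ δ : K[X], δ ≠ 0 ∧ ∀ b ∈ integralClosure K[X] F, δ • D b ∈ integralClosure K[X] F := by
  classical
  obtain ⟨S, hS⟩ := Module.Finite.fg_top (R := K[X]) (M := integralClosure K[X] F)
  obtain ⟨δ, hδ0, hδ⟩ := Algebra.IsAlgebraic.exists_integral_multiples K[X]
    (S.image fun b : integralClosure K[X] F => D (b : F))
  refine ⟨δ, hδ0, fun b hb => ?_⟩
  have hmem : (⟨b, hb⟩ : integralClosure K[X] F) ∈ Submodule.span K[X] (S : Set _) := by
    rw [hS]; trivial
  suffices ∀ x ∈ Submodule.span K[X] (S : Set (integralClosure K[X] F)),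
    δ • D (x : F) ∈ integralClosure K[X] F from this _ hmem
  intro x hx
  induction hx using Submodule.span_induction with
  | mem x hx => exact hδ _ (Finset.mem_image_of_mem _ hx)
  | zero => simp
  | add x y _ _ hx hy =>
    rw [Subalgebra.coe_add, map_add, smul_add]
    exact add_mem hx hy
  | smul p x _ hx =>
    have h1 : δ • D ((p • x : integralClosure K[X] F) : F) =
        p • (δ • D (x : F)) + δ • derivative p • (x : F) := by
      change δ • D (p • (x : F)) = _
      rw [Algebra.smul_def p (x : F), D.leibniz, D.map_algebraMap_polynomial, hD, smul_eq_mul,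
        smul_eq_mul, mul_one, smul_add, Algebra.smul_def p, Algebra.smul_def (derivative p),
        mul_comm (x : F), mul_smul_comm]
    rw [h1]
    exact add_mem (Subalgebra.smul_mem _ hx _)
      (Subalgebra.smul_mem _ (Subalgebra.smul_mem _ x.2 _) _)

end

section

variable {K B V : Type*} [Field K] [CommRing B] [CommRing V] [Algebra K B] [Algebra K V]
  [Algebra B V] [IsScalarTower K B V] (P : Ideal B) [P.IsPrime] [IsLocalization.AtPrime V P]

theorem IsLocalization.AtPrime.exists_sub_algebraMap_mem_maximalIdeal [IsLocalRing V]
    (hP : ∀ b : B, ∃ c : K, b - algebraMap K B c ∈ P) (x : V) :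
    ∃ c : K, x - algebraMap K V c ∈ IsLocalRing.maximalIdeal V := by
  have hmem : ∀ b : B, algebraMap B V b ∈ IsLocalRing.maximalIdeal V ↔ b ∈ P := fun b =>
    IsLocalization.AtPrime.to_map_mem_maximal_iff V P b
  obtain ⟨⟨b, s⟩, hx⟩ := IsLocalization.surj P.primeCompl x
  simp only at hx
  obtain ⟨c₁, hc₁⟩ := hP b
  obtain ⟨c₂, hc₂⟩ := hP s
  have hc0 : c₂ ≠ 0 := by
    rintro rfl
    rw [map_zero, sub_zero] at hc₂
    exact s.2 hc₂
  refine ⟨c₁ / c₂, ?_⟩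
  rw [← Ideal.mul_unit_mem_iff_mem _ (IsLocalization.map_units V s)]
  have h1 : (x - algebraMap K V (c₁ / c₂)) * algebraMap B V s =
      algebraMap B V (b - algebraMap K B c₁) -
        algebraMap K V (c₁ / c₂) * algebraMap B V (s - algebraMap K B c₂) := by
    have h2 : algebraMap K V (c₁ / c₂) * algebraMap K V c₂ = algebraMap K V c₁ := by
      rw [← map_mul, div_mul_cancel₀ _ hc0]
    rw [map_sub, map_sub, ← IsScalarTower.algebraMap_apply K B V,
      ← IsScalarTower.algebraMap_apply K B V]
    linear_combination hx - h2
  rw [h1]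
  exact Ideal.sub_mem _ ((hmem _).2 hc₁) (Ideal.mul_mem_left _ _ ((hmem _).2 hc₂))

theorem IsLocalization.AtPrime.mul_derivation_mem_range {K B V : Type*} [Field K]
    [CommRing B] [CommRing V] [Algebra B V] (P : Ideal B) [P.IsPrime]
    [IsLocalization.AtPrime V P] {F : Type*} [Field F] [Algebra K F] [Algebra B F] [Algebra V F] [IsScalarTower B V F] (D : Derivation K F F) (δ : B)
    (hδ : ∀ b : B, algebraMap B F δ * D (algebraMap B F b) ∈ (algebraMap B F).range) (x : V) :
    algebraMap V F (algebraMap B V δ) * D (algebraMap V F x) ∈ (algebraMap V F).range := by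
  obtain ⟨⟨b, s⟩, hx⟩ := IsLocalization.surj P.primeCompl x
  simp only at hx
  obtain ⟨v, hv⟩ := IsLocalization.map_units V s
  have h1 : algebraMap V F x * algebraMap B F s = algebraMap B F b := by
    rw [IsScalarTower.algebraMap_apply B V F, IsScalarTower.algebraMap_apply B V F, ← hx, map_mul]
  have h2 := congrArg (fun z => algebraMap B F δ * D z) h1
  simp only [D.leibniz, smul_eq_mul] at h2
  have hsv : algebraMap B F s = algebraMap V F v := by
    rw [IsScalarTower.algebraMap_apply B V F, hv]
  have hvinv : algebraMap V F (↑v⁻¹ : V) * algebraMap V F v = 1 := by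
    rw [← map_mul, Units.inv_mul, map_one]
  obtain ⟨z₁, hz₁⟩ := hδ b
  obtain ⟨z₂, hz₂⟩ := hδ s
  refine ⟨(algebraMap B V z₁ - x * algebraMap B V z₂) * (↑v⁻¹ : V), ?_⟩
  rw [map_mul, map_sub, map_mul, ← IsScalarTower.algebraMap_apply B V F,
    ← IsScalarTower.algebraMap_apply B V F, ← IsScalarTower.algebraMap_apply B V F, hz₁, hz₂, ← h2,
    hsv]
  linear_combination (algebraMap B F δ * D (algebraMap V F x)) * hvinv

end

section

variable {K F : Type*} [Field K] [Field F] [Algebra K F] [Algebra K[X] F] [IsScalarTower K K[X] F]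

theorem exists_order_of_transcendental [IsAlgClosed K] [CharZero K] {L : Type*} [Field L]
    [Algebra K[X] L] [IsFractionRing K[X] L] [Algebra L F] [IsScalarTower K[X] L F]
    [FiniteDimensional L F] (D : Derivation K F F)
    (hD : ∀ x, D x = 0 → x ∈ (algebraMap K F).range) (hDX : D (algebraMap K[X] F X) = 1)
    {J : Type*} [Fintype J] (a : J → F) (ha : ∀ j, a j ≠ 0) :
    ∃ n : J → ℤ, (∀ e : J → K, ∑ j, e j • (D (a j) / a j) = 0 → ∑ j, e j * (n j : K) = 0) ∧
      ∀ m : J → ℤ, ∏ j, a j ^ m j = algebraMap K[X] F X → ∑ j, m j * n j ≠ 0 := by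
  have : FaithfulSMul K[X] F := by
    rw [faithfulSMul_iff_algebraMap_injective, IsScalarTower.algebraMap_eq K[X] L F]
    exact (algebraMap L F).injective.comp (IsFractionRing.injective _ _)
  have : Algebra.IsAlgebraic K[X] F :=
    (IsFractionRing.comap_isAlgebraic_iff (A := K[X]) (K := L) (C := F)).2 inferInstance
  have : CharZero L := charZero_of_injective_ringHom ((algebraMap K[X] L).comp C).injective
  let B := integralClosure K[X] F
  have : IsDedekindDomain B := integralClosure.isDedekindDomain K[X] L F
  have : Module.Finite K[X] B := IsIntegralClosure.finite K[X] L F B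
  have : IsFractionRing B F := IsIntegralClosure.isFractionRing_of_finite_extension K[X] L F B
  have : (Ideal.span {(X : K[X])}).IsMaximal :=
    PrincipalIdealRing.isMaximal_of_irreducible irreducible_X
  obtain ⟨P, hPmax, hP⟩ := Ideal.exists_ideal_over_maximal_of_isIntegral (S := B)
    (Ideal.span {(X : K[X])}) (by
      rw [(RingHom.injective_iff_ker_eq_bot _).1 (FaithfulSMul.algebraMap_injective K[X] B)]
      exact bot_le)
  have hXP : algebraMap K[X] B X ∈ P := by
    rw [← Ideal.mem_comap, hP]
    exact Ideal.mem_span_singleton_self _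
  have hX0 : algebraMap K[X] B X ≠ 0 := by
    rw [Ne, map_eq_zero_iff _ (FaithfulSMul.algebraMap_injective K[X] B)]
    exact X_ne_zero
  have hP0 : P ≠ ⊥ := by
    rintro rfl
    exact hX0 hXP
  have hBres : ∀ b : B, ∃ c : K, b - algebraMap K B c ∈ P := by
    have hint : Algebra.IsIntegral K (B ⧸ P) := by
      refine ⟨fun b => ?_⟩
      obtain ⟨b, rfl⟩ := Ideal.Quotient.mk_surjective b
      obtain ⟨q, hq, hqb⟩ := (Algebra.IsIntegral.isIntegral (R := K[X]) b)
      refine ⟨q.map (evalRingHom 0), hq.map _, ?_⟩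
      have h1 : (algebraMap K (B ⧸ P)).comp (evalRingHom 0) =
          (Ideal.Quotient.mk P).comp (algebraMap K[X] B) := by
        refine Polynomial.ringHom_ext (fun c => ?_) ?_
        · rw [RingHom.comp_apply, coe_evalRingHom, eval_C, RingHom.comp_apply,
            IsScalarTower.algebraMap_apply K B (B ⧸ P), Ideal.Quotient.algebraMap_eq,
            IsScalarTower.algebraMap_apply K K[X] B, Polynomial.algebraMap_eq]
        · rw [RingHom.comp_apply, coe_evalRingHom, eval_X, map_zero, RingHom.comp_apply, eq_comm,
            Ideal.Quotient.eq_zero_iff_mem]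
          exact hXP
      rw [eval₂_map, h1, ← hom_eval₂, hqb, map_zero]
    intro b
    obtain ⟨c, hc⟩ := (IsAlgClosed.algebraMap_bijective_of_isIntegral (k := K) (K := B ⧸ P)).2
      (Ideal.Quotient.mk P b)
    exact ⟨c, Ideal.Quotient.eq.1 hc.symm⟩
  let V := Localization.subalgebra.ofField F P.primeCompl P.primeCompl_le_nonZeroDivisors
  have hloc : IsLocalization.AtPrime V P :=
    Localization.subalgebra.isLocalization_ofField F P.primeCompl P.primeCompl_le_nonZeroDivisors
  have : IsLocalRing V := IsLocalization.AtPrime.isLocalRing V P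
  have : IsDiscreteValuationRing V :=
    IsLocalization.AtPrime.isDiscreteValuationRing_of_dedekind_domain B hP0 V
  have hfrac : IsFractionRing V F := inferInstance
  have hmem : ∀ b : B, algebraMap B V b ∈ IsLocalRing.maximalIdeal V ↔ b ∈ P := fun b =>
    IsLocalization.AtPrime.to_map_mem_maximal_iff V P b
  have hres := IsLocalization.AtPrime.exists_sub_algebraMap_mem_maximalIdeal (V := V) P hBres
  obtain ⟨δ, hδ0, hδ⟩ := exists_mul_derivation_mem_integralClosure D hDX
  have hinjB : Function.Injective (algebraMap B V) :=
    IsLocalization.injective V P.primeCompl_le_nonZeroDivisors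
  have hδV : algebraMap B V (algebraMap K[X] B δ) ≠ 0 := by
    rw [Ne, map_eq_zero_iff _ hinjB, map_eq_zero_iff _ (FaithfulSMul.algebraMap_injective K[X] B)]
    exact hδ0
  have hDδ := IsLocalization.AtPrime.mul_derivation_mem_range (V := V) P D
    (algebraMap K[X] B δ) fun b => ⟨⟨_, hδ b b.2⟩, Algebra.smul_def _ _⟩
  obtain ⟨u, hu⟩ := IsDiscreteValuationRing.exists_irreducible V
  choose n y hny using fun j =>
    IsDiscreteValuationRing.exists_units_eq_smul_zpow_of_irreducible hu (ha j)
  have hny' : ∀ j, a j = algebraMap V F u ^ n j * algebraMap V F (y j) := fun j => by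
    rw [hny, Units.smul_def, Algebra.smul_def, mul_comm]
  refine ⟨n, fun e he => IsDiscreteValuationRing.sum_mul_order_eq_zero hres D hD hδV hDδ hu a n y
    hny' e he, fun m hm h0 => ?_⟩
  have h1 : algebraMap V F (∏ j, y j ^ m j : Vˣ) = algebraMap K[X] F X := by
    have h2 : ∏ j, a j ^ m j = algebraMap V F u ^ (∑ j, m j * n j) *
        ∏ j, algebraMap V F (y j) ^ m j := by
      have hU0 : algebraMap V F u ≠ 0 := by
        rw [Ne, map_eq_zero_iff _ (IsFractionRing.injective V F)]
        exact hu.ne_zero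
      have h3 : ∀ s : Finset J, algebraMap V F u ^ (∑ j ∈ s, m j * n j) =
          ∏ j ∈ s, algebraMap V F u ^ (m j * n j) := fun s => by
        induction s using Finset.cons_induction with
        | empty => simp
        | cons i s hi ih => rw [Finset.sum_cons, Finset.prod_cons, zpow_add₀ hU0, ih]
      rw [h3, ← Finset.prod_mul_distrib]
      refine Finset.prod_congr rfl fun j _ => ?_
      rw [hny', mul_zpow, ← zpow_mul, mul_comm (n j)]
    rw [← hm, h2, h0, zpow_zero, one_mul, Units.coe_prod, map_prod]
    refine Finset.prod_congr rfl fun j _ => ?_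
    exact (congrArg Units.val (map_zpow (Units.map (algebraMap V F : V →* F)) (y j) (m j))).trans
      (Units.val_zpow_eq_zpow_val _ _)
  have h2 : ((∏ j, y j ^ m j : Vˣ) : V) = algebraMap B V (algebraMap K[X] B X) :=
    IsFractionRing.injective V F h1
  have h3 := (hmem _).2 hXP
  rw [← h2] at h3
  exact (IsLocalRing.mem_maximalIdeal _).1 h3 (Units.isUnit _)

end

theorem exists_int_ne_zero_of_ne_zero {K J : Type*} [Field K] [CharZero K] [Fintype J] {e : J → K}
    (he : e ≠ 0) : ∃ m : J → ℤ, m ≠ 0 ∧ ∀ n : J → ℤ, ∑ j, e j * (n j : K) = 0 →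
      ∑ j, m j * n j = 0 := by
  classical
  obtain ⟨j₀, hj₀⟩ := Function.ne_iff.1 he
  obtain ⟨l, hl⟩ := Module.Projective.exists_dual_ne_zero ℚ hj₀
  obtain ⟨d, hd⟩ := IsLocalization.exist_integer_multiples_of_finite (nonZeroDivisors ℤ)
    fun j => l (e j)
  choose m hm using hd
  have hd0 : (d : ℤ) ≠ 0 := nonZeroDivisors.coe_ne_zero d
  have hm' : ∀ j, (m j : ℚ) = (d : ℤ) * l (e j) := fun j => by
    simpa [Algebra.smul_def] using hm j
  refine ⟨m, fun h0 => ?_, fun n hn => ?_⟩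
  · have := hm' j₀
    rw [h0, Pi.zero_apply, Int.cast_zero, eq_comm, mul_eq_zero] at this
    exact this.elim (fun h => hd0 (by exact_mod_cast h)) hl
  · have h1 : l (∑ j, e j * (n j : K)) = ∑ j, l (e j) * n j := by
      rw [map_sum]
      refine Finset.sum_congr rfl fun j _ => ?_
      rw [mul_comm, ← zsmul_eq_mul, map_zsmul, zsmul_eq_mul, mul_comm]
    rw [hn, map_zero] at h1
    have h2 : ((∑ j, m j * n j : ℤ) : ℚ) = (d : ℤ) * ∑ j, l (e j) * n j := by
      push_cast
      rw [Finset.mul_sum]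
      exact Finset.sum_congr rfl fun j _ => by rw [hm', mul_assoc]
    rw [← h1, mul_zero] at h2
    exact_mod_cast h2

theorem transcendental_of_notMem_range {K F : Type*} [Field K] [Field F] [Algebra K F]
    [IsAlgClosed K] {b : F} (hb : b ∉ (algebraMap K F).range) : Transcendental K b := by
  intro hba
  obtain ⟨c, hc⟩ := (IsAlgClosed.algebraMap_bijective_of_isIntegral (k := K)
    (K := integralClosure K F)).2 ⟨b, hba.isIntegral⟩
  exact hb ⟨c, congrArg Subtype.val hc⟩

theorem Algebra.isAlgebraic_adjoin_of_trdeg_le_one {K F : Type*} [Field K] [Field F] [Algebra K F]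
    (htr : Algebra.trdeg K F ≤ 1) {b : F} (hb : Transcendental K b) :
    Algebra.IsAlgebraic (Algebra.adjoin K {b}) F := by
  have h1 : AlgebraicIndependent K fun _ : Unit => b :=
    algebraicIndependent_unique_type_iff.2 hb
  have h2 := (h1.isTranscendenceBasis_of_lift_trdeg_le_of_finite (by simpa using htr)).isAlgebraic
  have hr : Set.range (fun _ : Unit => b) = {b} := Set.range_const
  rwa [hr] at h2

/-- Logarithmic differentials of multiplicatively independent functions on a curve are linearly
independent over the constants. -/
theorem Derivation.eq_zero_of_sum_smul_div_eq_zero {K F : Type*} [Field K] [Field F] [Algebra K F]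
    [IsAlgClosed K] [CharZero K] [Algebra.EssFiniteType K F] (htr : Algebra.trdeg K F ≤ 1)
    (D : Derivation K F F) (hD : ∀ x, D x = 0 → x ∈ (algebraMap K F).range)
    {J : Type*} [Fintype J] (a : J → F) (ha : ∀ j, a j ≠ 0)
    (hind : ∀ m : J → ℤ, ∏ j, a j ^ m j ∈ (algebraMap K F).range → m = 0) (e : J → K)
    (he : ∑ j, e j • (D (a j) / a j) = 0) : e = 0 := by
  by_contra hne
  obtain ⟨m, hm0, hm⟩ := exists_int_ne_zero_of_ne_zero hne
  set b := ∏ j, a j ^ m j with hb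
  have hbK : b ∉ (algebraMap K F).range := fun h => hm0 (hind m h)
  have hbt : Transcendental K b := transcendental_of_notMem_range hbK
  have hDb : D b ≠ 0 := fun h => hbK (hD b h)
  let : Algebra K[X] F := (aeval b).toAlgebra
  have htower : IsScalarTower K K[X] F := IsScalarTower.of_algebraMap_eq fun c => by
    exact (aeval_C b c).symm
  have : FaithfulSMul K[X] F := by
    rw [faithfulSMul_iff_algebraMap_injective]
    exact transcendental_iff_injective.1 hbt
  let : Algebra (FractionRing K[X]) F := FractionRing.liftAlgebra K[X] F
  have : IsScalarTower K[X] (FractionRing K[X]) F := inferInstance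
  have halg : Algebra.IsAlgebraic K[X] F := by
    have h3 := Algebra.isAlgebraic_adjoin_of_trdeg_le_one htr hbt
    let f : K[X] →ₐ[K] Algebra.adjoin K {b} := aeval ⟨b, Algebra.self_mem_adjoin_singleton K b⟩
    refine Algebra.IsAlgebraic.of_ringHom_of_comp_eq (S := Algebra.adjoin K {b}) (B := F)
      (f : K[X] →+* Algebra.adjoin K {b}) (RingHom.id F) ?_ Function.injective_id ?_
    · rintro ⟨x, hx⟩
      obtain ⟨p, rfl⟩ := Algebra.adjoin_mem_exists_aeval K b hx
      exact ⟨p, Subtype.ext (by simp [f])⟩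
    · refine RingHom.ext fun p => ?_
      change ((aeval (⟨b, _⟩ : Algebra.adjoin K {b}) p : Algebra.adjoin K {b}) : F) = aeval b p
      simp
  have : Algebra.EssFiniteType K[X] F := Algebra.EssFiniteType.of_comp K K[X] F
  have : Algebra.EssFiniteType (FractionRing K[X]) F := Algebra.EssFiniteType.of_comp K[X] _ F
  have : Algebra.IsAlgebraic (FractionRing K[X]) F :=
    (IsFractionRing.comap_isAlgebraic_iff (A := K[X]) (K := FractionRing K[X]) (C := F)).1 halg
  have : FiniteDimensional (FractionRing K[X]) F :=
    Algebra.finite_of_essFiniteType_of_isAlgebraic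
  have hX : algebraMap K[X] F X = b := aeval_X b
  obtain ⟨n, hn, hn'⟩ := exists_order_of_transcendental (L := FractionRing K[X]) ((D b)⁻¹ • D)
    (fun x hx => hD x ((mul_eq_zero.1 hx).resolve_left (inv_ne_zero hDb)))
    (by rw [hX]; exact inv_mul_cancel₀ hDb) a ha
  refine hn' m (by rw [hX]) (hm n (hn e ?_))
  have := congrArg ((D b)⁻¹ * ·) he
  simp only [mul_zero, Finset.mul_sum] at this
  rw [← this]
  refine Finset.sum_congr rfl fun j _ => ?_
  change e j • ((D b)⁻¹ * D (a j) / a j) = _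
  rw [mul_smul_comm, mul_div_assoc]

section

variable {K F : Type*} [Field K] [Field F] [Algebra K F] [Algebra K[X] F] [IsScalarTower K K[X] F]

theorem Algebra.trdeg_le_one_of_isAlgebraic_polynomial [FaithfulSMul K[X] F]
    [Algebra.IsAlgebraic K[X] F] : Algebra.trdeg K F ≤ 1 := by
  let t := algebraMap K[X] F X
  let f : K[X] →ₐ[K] Algebra.adjoin K {t} := aeval ⟨t, Algebra.self_mem_adjoin_singleton K t⟩
  have hf : (algebraMap (Algebra.adjoin K {t}) F).comp (f : K[X] →+* Algebra.adjoin K {t}) =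
      algebraMap K[X] F := by
    refine Polynomial.ringHom_ext (fun c => ?_) ?_
    · have : f (C c) = algebraMap K _ c := f.commutes c
      rw [RingHom.comp_apply, RingHom.coe_coe, this, ← IsScalarTower.algebraMap_apply,
        IsScalarTower.algebraMap_apply K K[X] F, Polynomial.algebraMap_eq]
    · rw [RingHom.comp_apply, RingHom.coe_coe, aeval_X]
      rfl
  have : Algebra.IsAlgebraic (Algebra.adjoin K {t}) F := by
    refine Algebra.IsAlgebraic.ringHom_of_comp_eq (R := K[X]) (A := F)
      (f : K[X] →+* Algebra.adjoin K {t}) (RingHom.id F) ?_ Function.surjective_id hf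
    refine Function.Injective.of_comp (f := algebraMap (Algebra.adjoin K {t}) F) ?_
    rw [← RingHom.coe_comp, hf]
    exact FaithfulSMul.algebraMap_injective K[X] F
  simpa using Algebra.IsAlgebraic.trdeg_le_cardinalMk K ({t} : Set F)

theorem exists_derivation_algebraMap_X_eq_one (L : Type*) [Field L] [CharZero L]
    [Algebra K[X] L] [IsFractionRing K[X] L] [Algebra L F] [IsScalarTower K[X] L F]
    [Algebra.IsAlgebraic L F] : ∃ D : Derivation K F F, D (algebraMap K[X] F X) = 1 := by
  have : Algebra.FormallyEtale K[X] L := .of_isLocalization (nonZeroDivisors K[X])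
  have : Algebra.FormallyEtale L F := .of_isSeparable L F
  have : Algebra.FormallyEtale K[X] F := .comp K[X] L F
  let d : Derivation K K[X] F := mkDerivation K 1
  let l' : TensorProduct K[X] F Ω[K[X]⁄K] →ₗ[F] F :=
    TensorProduct.AlgebraTensorModule.lift
      (LinearMap.toSpanSingleton F (Ω[K[X]⁄K] →ₗ[K[X]] F) d.liftKaehlerDifferential)
  let e := (KaehlerDifferential.tensorKaehlerEquivOfFormallyEtale K K[X] F).symm
  refine ⟨(l'.comp e.toLinearMap).compDer (KaehlerDifferential.D K F), ?_⟩
  change l' (e (KaehlerDifferential.D K F (algebraMap K[X] F X))) = 1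
  rw [KaehlerDifferential.tensorKaehlerEquivOfFormallyEtale_symm_D_algebraMap]
  simp [l', d, mkDerivation_X]

omit [Algebra K[X] F] [IsScalarTower K K[X] F] in
theorem Derivation.mem_range_of_apply_eq_zero [IsAlgClosed K] [CharZero K]
    (htr : Algebra.trdeg K F ≤ 1) (D : Derivation K F F) (hD : D ≠ 0) {x : F} (hx : D x = 0) :
    x ∈ (algebraMap K F).range := by
  by_contra hxK
  have : CharZero F := charZero_of_injective_algebraMap (algebraMap K F).injective
  let E : IntermediateField K F :=
    { carrier := {y | D y = 0}
      mul_mem' := fun {a b} ha hb => by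
        change D _ = 0 at ha hb ⊢
        rw [D.leibniz, ha, hb, smul_zero, smul_zero, add_zero]
      add_mem' := fun {a b} ha hb => by
        change D _ = 0 at ha hb ⊢
        rw [map_add, ha, hb, add_zero]
      algebraMap_mem' := fun c => D.map_algebraMap c
      inv_mem' := fun a ha => by
        change D a = 0 at ha
        change D a⁻¹ = 0
        rw [D.leibniz_inv, ha, smul_zero] }
  have hE : ∀ y : E, D y = 0 := fun y => y.2
  have hle : Algebra.adjoin K {x} ≤ E.toSubalgebra :=
    Algebra.adjoin_le (Set.singleton_subset_iff.2 hx)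
  have halg := Algebra.isAlgebraic_adjoin_of_trdeg_le_one htr (transcendental_of_notMem_range hxK)
  let D' : Derivation E F F := Derivation.mk'
    { toFun := D
      map_add' := map_add D
      map_smul' := fun c y => by
        rw [IntermediateField.smul_def, smul_eq_mul, D.leibniz, hE, smul_zero, add_zero]
        rfl } D.leibniz
  apply hD
  ext t
  have ht : IsAlgebraic E t :=
    IsAlgebraic.tower_top_of_subalgebra_le hle (halg.isAlgebraic t)
  have h1 := Derivation.map_aeval D' (minpoly E t) t
  rw [minpoly.aeval, map_zero, eq_comm, smul_eq_zero] at h1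
  exact h1.resolve_left ((minpoly.irreducible ht.isIntegral).separable.aeval_derivative_ne_zero
    (minpoly.aeval E t))

end

section PowMod

variable {R : Type*} [CommRing R]

/-- The matrix of multiplication by `w` on `R[X] ⧸ (g)` with respect to the powers of `X`. -/
noncomputable def powModMatrix (g w : R[X]) : Matrix (Fin g.natDegree) (Fin g.natDegree) R :=
  Matrix.of fun a b => ((w * X ^ (a : ℕ)) %ₘ g).coeff b

theorem modByMonic_eq_sum_fin {g : R[X]} (hg : g.Monic) (hgd : g.natDegree ≠ 0) (p : R[X]) :
    p %ₘ g = ∑ b : Fin g.natDegree, C ((p %ₘ g).coeff b) * X ^ (b : ℕ) := by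
  rw [Fin.sum_univ_eq_sum_range (fun b => C ((p %ₘ g).coeff b) * X ^ b)]
  exact as_sum_range_C_mul_X_pow' _ (natDegree_modByMonic_lt p hg fun h => hgd (by simp [h]))

theorem dvd_mul_X_pow_sub_powModMatrix {g : R[X]} (hg : g.Monic) (hgd : g.natDegree ≠ 0) (w : R[X])
    (a : Fin g.natDegree) :
    g ∣ w * X ^ (a : ℕ) - ∑ b, C (powModMatrix g w a b) * X ^ (b : ℕ) := by
  simp only [powModMatrix, Matrix.of_apply]
  rw [← modByMonic_eq_sum_fin hg hgd]
  exact ⟨_, sub_eq_of_eq_add' (modByMonic_add_div (w * X ^ (a : ℕ)) g).symm⟩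

theorem powModMatrix_sum_smul {g : R[X]} {J : Type*} [Fintype J] (e : J → R) (w : J → R[X]) :
    powModMatrix g (∑ j, C (e j) * w j) = ∑ j, e j • powModMatrix g (w j) := by
  ext a b
  simp only [powModMatrix, Matrix.of_apply, Matrix.sum_apply, Matrix.smul_apply, Finset.sum_mul]
  rw [← modByMonicHom_apply, map_sum, finsetSum_coeff]
  refine Finset.sum_congr rfl fun j _ => ?_
  rw [mul_assoc, ← smul_eq_C_mul, map_smul, coeff_smul, modByMonicHom_apply]

theorem det_powModMatrix_ne_zero [IsDomain R] {g : R[X]} (hg : g.Monic) (hgd : g.natDegree ≠ 0)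
    (hprime : Prime g) {w : R[X]} (hw : ¬ g ∣ w) : (powModMatrix g w).det ≠ 0 := by
  intro h0
  obtain ⟨v, hv0, hv⟩ := Matrix.exists_vecMul_eq_zero_iff.2 h0
  set q : R[X] := ∑ a, C (v a) * X ^ (a : ℕ) with hq
  have hdvd : g ∣ w * q := by
    have h1 : w * q = ∑ a, C (v a) * (w * X ^ (a : ℕ) -
        ∑ b, C (powModMatrix g w a b) * X ^ (b : ℕ)) := by
      have h2 : ∑ a, C (v a) * ∑ b, C (powModMatrix g w a b) * X ^ (b : ℕ) = 0 := by
        simp only [Finset.mul_sum]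
        rw [Finset.sum_comm]
        refine Finset.sum_eq_zero fun b _ => ?_
        have h3 := congrFun hv b
        rw [Matrix.vecMul, dotProduct, Pi.zero_apply] at h3
        simp only [← mul_assoc, ← Finset.sum_mul, ← C_mul, ← map_sum, h3, C_0, zero_mul]
      simp_rw [mul_sub]
      rw [Finset.sum_sub_distrib, h2, sub_zero, hq, Finset.mul_sum]
      exact Finset.sum_congr rfl fun a _ => mul_left_comm _ _ _
    rw [h1]
    exact Finset.dvd_sum fun a _ => (dvd_mul_X_pow_sub_powModMatrix hg hgd w a).mul_left _
  have hqd : q.degree < g.degree := by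
    rw [degree_eq_natDegree hg.ne_zero, hq]
    refine (degree_sum_le _ _).trans_lt ((Finset.sup_lt_iff (WithBot.bot_lt_coe _)).2 fun a _ => ?_)
    exact (degree_C_mul_X_pow_le _ _).trans_lt (by exact_mod_cast a.2)
  have hq0 := eq_zero_of_dvd_of_degree_lt ((hprime.dvd_or_dvd hdvd).resolve_left hw) hqd
  apply hv0
  ext1 a
  have := congrArg (coeff · a) hq0
  simpa [hq, finsetSum_coeff, coeff_C_mul, coeff_X_pow, Fin.val_inj] using this

theorem eval_det_powModMatrix_eq_zero {K : Type*} [Field K] {g : K[X][X]} (hg : g.Monic)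
    (hgd : g.natDegree ≠ 0) {w : K[X][X]} {τ b : K} (hgτ : g.evalEval τ b = 0)
    (hwτ : w.evalEval τ b = 0) : (powModMatrix g w).det.eval τ = 0 := by
  rw [← coe_evalRingHom, RingHom.map_det]
  refine Matrix.exists_mulVec_eq_zero_iff.1 ⟨fun i => b ^ (i : ℕ), fun h => ?_, ?_⟩
  · have := congrFun h ⟨0, Nat.pos_of_ne_zero hgd⟩
    simp at this
  · ext1 a
    obtain ⟨q, hq⟩ := dvd_mul_X_pow_sub_powModMatrix hg hgd w a
    have h1 := congrArg (evalEvalRingHom τ b) hq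
    simp only [map_sub, map_mul, map_sum, coe_evalEvalRingHom, hgτ, hwτ, zero_mul, zero_sub,
      neg_eq_zero, map_pow, evalEval_C, evalEval_X] at h1
    simpa [Matrix.mulVec, dotProduct] using h1

end PowMod

theorem exists_subring_ringHom_of_ker_le {A F K : Type*} [CommRing A] [Field F] [Field K]
    (θ : A →+* F) (ev : A →+* K) (hker : ∀ x, θ x = 0 → ev x = 0) {h : A} (hev : ev h ≠ 0) :
    ∃ (R : Subring F) (φ : R →+* K), ∀ p, ∃ hp : θ p / θ h ∈ R, φ ⟨_, hp⟩ = ev p / ev h := by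
  have hθ : θ h ≠ 0 := fun h0 => hev (hker h h0)
  let S := Localization.Away h
  have hu : IsUnit (θ h) := hθ.isUnit
  have hu' : IsUnit (ev h) := hev.isUnit
  let θ' : S →+* F := IsLocalization.Away.lift h hu
  let ev' : S →+* K := IsLocalization.Away.lift h hu'
  have hθ' : ∀ p, θ' (algebraMap A S p) = θ p := IsLocalization.Away.lift_eq h hu
  have hev' : ∀ p, ev' (algebraMap A S p) = ev p := IsLocalization.Away.lift_eq h hu'
  have hker' : RingHom.ker θ'.rangeRestrict ≤ RingHom.ker ev' := by
    intro x hx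
    rw [RingHom.ker_rangeRestrict, RingHom.mem_ker] at hx
    obtain ⟨⟨p, s⟩, hs⟩ := IsLocalization.surj (Submonoid.powers h) x
    simp only at hs
    have h1 := congrArg θ' hs
    rw [map_mul, hx, zero_mul, hθ'] at h1
    have h2 := congrArg ev' hs
    rw [map_mul, hev', hev', hker p h1.symm, mul_eq_zero] at h2
    refine h2.resolve_right ?_
    obtain ⟨n, hn⟩ := s.2
    rw [← hn]
    simpa using fun h0 => absurd h0 hev
  let φ := RingHom.liftOfSurjective θ'.rangeRestrict θ'.rangeRestrict_surjective ⟨ev', hker'⟩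
  refine ⟨θ'.range, φ, fun p => ?_⟩
  have hx : ∃ x : S, x * algebraMap A S h = algebraMap A S p :=
    ⟨_, IsLocalization.mk'_spec S p ⟨h, Submonoid.mem_powers h⟩⟩
  obtain ⟨x, hx⟩ := hx
  have h1 : θ' x = θ p / θ h := by
    rw [eq_div_iff hθ, ← hθ', ← hθ' p, ← map_mul, hx]
  have h2 : ev' x = ev p / ev h := by
    rw [eq_div_iff hev, ← hev', ← hev' p, ← map_mul, hx]
  refine ⟨⟨x, h1⟩, ?_⟩
  rw [← h2]
  have h3 := RingHom.liftOfSurjective_comp_apply θ'.rangeRestrict θ'.rangeRestrict_surjective ⟨ev', hker'⟩ x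
  rw [← h3]
  congr 1
  exact Subtype.ext h1.symm

theorem exists_primitive_presentation {K F L : Type*} [Field K] [Field F] [Algebra K[X] F]
    [Field L] [CharZero L] [Algebra K[X] L] [IsFractionRing K[X] L] [Algebra L F]
    [IsScalarTower K[X] L F] [FiniteDimensional L F] :
    ∃ (g : K[X][X]) (β : F), g.Monic ∧ g.natDegree ≠ 0 ∧ Prime g ∧ (∀ p, aeval β p = 0 ↔ g ∣ p) ∧
      ∀ x : F, ∃ h : K[X], h ≠ 0 ∧ ∃ p : K[X][X], algebraMap K[X] F h * x = aeval β p := by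
  have : FaithfulSMul K[X] F := by
    rw [faithfulSMul_iff_algebraMap_injective, IsScalarTower.algebraMap_eq K[X] L F]
    exact (algebraMap L F).injective.comp (IsFractionRing.injective _ _)
  have : Algebra.IsAlgebraic K[X] F :=
    (IsFractionRing.comap_isAlgebraic_iff (A := K[X]) (K := L) (C := F)).2 inferInstance
  obtain ⟨α, hα⟩ := Field.exists_primitive_element L F
  obtain ⟨y, hy0, hy⟩ := (Algebra.IsAlgebraic.isAlgebraic (R := K[X]) α).exists_integral_multiple
  set β := y • α with hβ
  have hy' : algebraMap K[X] F y ≠ 0 := by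
    rwa [Ne, map_eq_zero_iff _ (FaithfulSMul.algebraMap_injective K[X] F)]
  have hadj : Algebra.adjoin L {β} = ⊤ := by
    rw [← IntermediateField.adjoin_simple_eq_top_iff_of_isAlgebraic
      (Algebra.IsAlgebraic.isAlgebraic β), eq_top_iff, ← hα, IntermediateField.adjoin_simple_le_iff]
    have : α = (algebraMap L F (algebraMap K[X] L y))⁻¹ * β := by
      rw [← IsScalarTower.algebraMap_apply, hβ, Algebra.smul_def, inv_mul_cancel_left₀ hy']
    rw [this]
    exact mul_mem (inv_mem (IntermediateField.algebraMap_mem _ _))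
      (IntermediateField.mem_adjoin_simple_self L β)
  refine ⟨minpoly K[X] β, β, minpoly.monic hy, (minpoly.natDegree_pos hy).ne',
    minpoly.prime_of_isIntegrallyClosed hy, fun p => minpoly.isIntegrallyClosed_dvd_iff hy p,
    fun x => ?_⟩
  have hx : x ∈ Algebra.adjoin L {β} := hadj ▸ Algebra.mem_top
  obtain ⟨q, rfl⟩ := Algebra.adjoin_mem_exists_aeval L β hx
  obtain ⟨h, hh, hp⟩ := IsLocalization.integerNormalization_spec (nonZeroDivisors K[X]) q
  refine ⟨h, nonZeroDivisors.ne_zero hh,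
    IsLocalization.integerNormalization (nonZeroDivisors K[X]) q, ?_⟩
  rw [← aeval_map_algebraMap L β (IsLocalization.integerNormalization _ q), hp,
    ← algebraMap_smul L h q, map_smul, Algebra.smul_def,
    ← IsScalarTower.algebraMap_apply]

section Groups

/-- A finite family in a commutative group is, up to powers, generated modulo a subgroup by a
subfamily independent modulo that subgroup. -/
theorem exists_finset_independent_modulo {G κ : Type*} [CommGroup G] [Fintype κ] (H : Subgroup G)
    (a : κ → G) : ∃ J : Finset κ, (∀ m : J → ℤ, ∏ j : J, a j ^ m j ∈ H → m = 0) ∧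
      ∃ N : ℤ, N ≠ 0 ∧ ∀ i, ∃ n : J → ℤ, a i ^ N * ∏ j : J, a j ^ n j ∈ H := by
  classical
  let P : Finset κ → Prop := fun J =>
    ∀ m : κ → ℤ, (∀ i ∉ J, m i = 0) → ∏ i, a i ^ m i ∈ H → m = 0
  have hP : P ∅ := fun m hm _ => funext fun i => hm i (Finset.notMem_empty i)
  obtain ⟨J, hJ⟩ := (Set.toFinite {J | P J}).exists_maximal ⟨∅, hP⟩
  have hJP : P J := hJ.prop
  have hprod : ∀ m : κ → ℤ, (∀ i ∉ J, m i = 0) → ∏ i, a i ^ m i = ∏ j : J, a j ^ m j := by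
    intro m hm
    rw [← Finset.prod_subset (Finset.subset_univ J) fun i _ hi => by rw [hm i hi, zpow_zero],
      ← Finset.prod_coe_sort]
  have hi : ∀ i, ∃ N : ℤ, N ≠ 0 ∧ ∃ n : J → ℤ, a i ^ N * ∏ j : J, a j ^ n j ∈ H := by
    intro i
    by_cases hiJ : i ∈ J
    · refine ⟨1, one_ne_zero, fun j => if j = ⟨i, hiJ⟩ then -1 else 0, ?_⟩
      rw [Finset.prod_eq_single (⟨i, hiJ⟩ : J) (fun j _ hj => by simp [hj]) (by simp)]
      simp
    · have : ¬ P (insert i J) := fun h =>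
        hiJ (hJ.le_of_ge h (Finset.subset_insert i J) (Finset.mem_insert_self i J))
      simp only [P, not_forall] at this
      obtain ⟨m, hm, hmH, hm0⟩ := this
      have hmi : m i ≠ 0 := fun h0 => hm0 (hJP m (fun l hl => by
        by_cases hli : l = i
        · rw [hli, h0]
        · exact hm l (by simp [hli, hl])) hmH)
      refine ⟨m i, hmi, fun j => m j, ?_⟩
      rw [← Finset.prod_subset (Finset.subset_univ (insert i J))
        fun l _ hl => by rw [hm l hl, zpow_zero], Finset.prod_insert hiJ,
        ← Finset.prod_coe_sort] at hmH
      exact hmH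
  choose N hN n hn using hi
  refine ⟨J, fun m hm => ?_, ∏ i, N i, Finset.prod_ne_zero_iff.2 fun i _ => hN i, fun i => ?_⟩
  · have h1 := hJP (fun i => if h : i ∈ J then m ⟨i, h⟩ else 0) (fun i hi => by simp [hi]) (by
      rw [hprod _ fun i hi => by simp [hi]]
      simpa using hm)
    ext1 j
    simpa using congrFun h1 j
  · refine ⟨fun j => n i j * ∏ l ∈ Finset.univ.erase i, N l, ?_⟩
    have h1 := H.zpow_mem (hn i) (∏ l ∈ Finset.univ.erase i, N l)
    rw [mul_zpow, ← zpow_mul, Finset.mul_prod_erase _ _ (Finset.mem_univ i),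
      ← Finset.prod_zpow] at h1
    simpa only [zpow_mul] using h1

theorem zpow_finsetSum {G κ : Type*} [CommGroup G] (x : G) (s : Finset κ) (n : κ → ℤ) :
    x ^ ∑ i ∈ s, n i = ∏ i ∈ s, x ^ n i := by
  classical
  induction s using Finset.induction_on with
  | empty => simp
  | insert i s hi ih => rw [Finset.sum_insert hi, Finset.prod_insert hi, zpow_add, ih]

theorem prod_zpow_eq_one_of_retraction {G C κ J : Type*} [CommGroup G] [CommGroup C] [Fintype κ]
    [Fintype J] (incl : C →* G) (φ : G →* C) (hφ : ∀ c, φ (incl c) = c) (A : κ → G) (B : J → G)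
    (c : κ → C) {N : ℤ} (q : κ → J → ℤ) (hN : ∀ k, A k ^ N * ∏ j, B j ^ q k j = incl (c k))
    (hind : ∀ (n : J → ℤ) (m : κ → ℤ), (∏ j, φ (B j) ^ n j) * ∏ i, c i ^ m i = 1 → n = 0)
    (htor : ∀ v : G, v ^ N = 1 → v ∈ incl.range) (n : κ → ℤ) (h : φ (∏ k, A k ^ n k) = 1) :
    ∏ k, A k ^ n k = 1 := by
  set v := ∏ k, A k ^ n k with hv
  set r : J → ℤ := fun j => ∑ k, q k j * n k with hr
  have h1 : v ^ N * ∏ j, B j ^ r j = incl (∏ k, c k ^ n k) := by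
    have h2 : ∏ j, B j ^ r j = ∏ k, ∏ j, (B j ^ q k j) ^ n k := by
      rw [Finset.prod_comm]
      refine Finset.prod_congr rfl fun j _ => ?_
      simp only [hr, zpow_finsetSum, zpow_mul]
    rw [h2, hv, ← Finset.prod_zpow, ← Finset.prod_mul_distrib, map_prod]
    refine Finset.prod_congr rfl fun k _ => ?_
    rw [map_zpow, ← hN, mul_zpow, Finset.prod_zpow, zpow_comm]
  have h2 : (∏ j, φ (B j) ^ r j) * ∏ i, c i ^ (-n i) = 1 := by
    have := congrArg φ h1
    rw [map_mul, map_zpow, h, one_zpow, one_mul, hφ, map_prod] at this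
    simp only [map_zpow] at this
    rw [this]
    simp only [zpow_neg, Finset.prod_inv_distrib, mul_inv_cancel]
  have hr0 := hind _ _ h2
  have h3 : ∏ k, c k ^ n k = 1 := by
    simpa [hr0] using h2
  have h4 : v ^ N = 1 := by
    simpa [hr0, h3] using h1
  obtain ⟨x, hx⟩ := htor v h4
  rw [← hx, hφ] at h
  rw [← hx, h, map_one]

end Groups

theorem exists_common_denominator {R A F κ : Type*} [CommRing R] [IsDomain R] [CommRing A]
    [CommRing F] [Algebra R A] [Algebra R F] (θ : A →ₐ[R] F) [Fintype κ] (x : κ → F)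
    (hx : ∀ k, ∃ h : R, h ≠ 0 ∧ ∃ p : A, algebraMap R F h * x k = θ p) :
    ∃ h : R, h ≠ 0 ∧ ∀ k, ∃ p : A, algebraMap R F h * x k = θ p := by
  classical
  choose h hh p hp using hx
  refine ⟨∏ k, h k, Finset.prod_ne_zero_iff.2 fun k _ => hh k, fun k =>
    ⟨algebraMap R A (∏ l ∈ Finset.univ.erase k, h l) * p k, ?_⟩⟩
  rw [map_mul, ← hp, AlgHom.commutes, ← mul_assoc, ← map_mul,
    Finset.prod_erase_mul _ _ (Finset.mem_univ k)]

theorem exists_finite_set_forall_evalEval_eq_zero_imp_dvd {K ι : Type*} [Field K] [Fintype ι]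
    {g : K[X][X]} (hg : g.Monic) (hgd : g.natDegree ≠ 0) (hprime : Prime g) (p : ι → K[X][X]) :
    ∃ T₀ : Set K, T₀.Finite ∧ ∃ E : ℕ, ∀ τ b : K,
      (∀ P : K[X], P ≠ 0 → P.natDegree ≤ E → (∀ i, P.coeff i ∈ Subfield.closure T₀) →
        P.eval τ ≠ 0) → g.evalEval τ b = 0 →
      ∀ n : ι → ℤ, (∑ i, n i • p i).evalEval τ b = 0 → g ∣ ∑ i, n i • p i := by
  classical
  let Q := pencilDet fun i => powModMatrix g (p i)
  refine ⟨⋃ i ∈ Q.support, ((Q.coeff i).coeffs : Set K),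
    Q.support.finite_toSet.biUnion fun i _ => Finset.finite_toSet _, Q.natDegree,
    fun τ b hτ hgτ n hn => ?_⟩
  by_contra hdvd
  have hsum : ∑ i, n i • p i = ∑ i, C (C (n i : K)) * p i :=
    Finset.sum_congr rfl fun i _ => by simp [zsmul_eq_mul]
  have hP := pencilDet_map_eval₂Hom (fun i => powModMatrix g (p i)) (RingHom.id K)
    (fun i => (n i : K))
  have hid : ∀ i, (powModMatrix g (p i)).map (Polynomial.map (RingHom.id K)) =
      powModMatrix g (p i) := fun i => by
    ext1 a b
    simp
  simp only [hid] at hP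
  rw [← powModMatrix_sum_smul, ← hsum] at hP
  refine hτ _ (det_powModMatrix_ne_zero hg hgd hprime hdvd) ?_ (fun i => ?_)
    (eval_det_powModMatrix_eq_zero hg hgd hgτ hn)
  · rw [← hP]
    exact natDegree_map_le
  · rw [← hP, coeff_map]
    by_cases hi : i ∈ Q.support
    · rw [MvPolynomial.coe_eval₂Hom, MvPolynomial.eval₂_eq']
      refine sum_mem fun m hm => mul_mem (Subfield.subset_closure (Set.mem_biUnion hi ?_))
        (prod_mem fun j _ => pow_mem (intCast_mem _ _) _)
      exact MvPolynomial.coeff_mem_coeffs _ (MvPolynomial.mem_support_iff.1 hm)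
    · rw [notMem_support_iff.1 hi, map_zero]
      exact zero_mem _

theorem Derivation.map_aeval_bivariate {K F : Type*} [Field K] [Field F] [Algebra K F]
    [Algebra K[X] F] [IsScalarTower K K[X] F] (D : Derivation K F F)
    (hD : D (algebraMap K[X] F X) = 1) (β : F) (p : K[X][X]) :
    D (aeval β p) = aeval β (derivX K p) + aeval β (derivative p) * D β := by
  induction p using Polynomial.induction_on with
  | C c => simp [Derivation.map_algebraMap_polynomial, hD]
  | add p q hp hq => simp only [map_add, hp, hq]; ring
  | monomial n c ih =>
    rw [pow_succ, ← mul_assoc]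
    generalize C c * X ^ n = q at ih
    simp only [derivX_mul, derivX_X, derivative_mul, derivative_X, map_mul, map_add, aeval_X,
      D.leibniz, ih, smul_eq_mul, map_zero, map_one]
    ring

section Field

variable {K F : Type*} [Field K] [Field F] [Algebra K F] [IsAlgClosed K] [CharZero K]
  [Algebra K[X] F] [IsScalarTower K K[X] F]

/-- Independence of logarithmic derivatives, in terms of a polynomial presentation of the
function field. -/
theorem eq_zero_of_dvd_sum_logDeriv (L : Type*) [Field L] [CharZero L] [Algebra K[X] L]
    [IsFractionRing K[X] L] [Algebra L F] [IsScalarTower K[X] L F] [FiniteDimensional L F]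
    {g : K[X][X]} {β : F} (hβ : ∀ p, aeval β p = 0 ↔ g ∣ p)
    (hg' : aeval β (derivative g) ≠ 0) {J : Type*} [Fintype J] (f f' : J → K[X][X])
    (hf : ∀ j, aeval β (f j) ≠ 0)
    {h : K[X]} (hh : h ≠ 0) (hf' : ∀ j, algebraMap K[X] F h * (aeval β (f j))⁻¹ = aeval β (f' j))
    (hind : ∀ m : J → ℤ, ∏ j, aeval β (f j) ^ m j ∈ (algebraMap K F).range → m = 0) (e : J → K)
    (he : g ∣ ∑ j, C (C (e j)) *
      ((derivative g * derivX K (f j) - derivX K g * derivative (f j)) * f' j)) : e = 0 := by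
  have hinj : Function.Injective (algebraMap K[X] F) := by
    rw [IsScalarTower.algebraMap_eq K[X] L F]
    exact (algebraMap L F).injective.comp (IsFractionRing.injective _ _)
  have : FaithfulSMul K[X] F := (faithfulSMul_iff_algebraMap_injective _ _).2 hinj
  have : Algebra.IsAlgebraic K[X] F :=
    (IsFractionRing.comap_isAlgebraic_iff (A := K[X]) (K := L) (C := F)).2 inferInstance
  have htr := Algebra.trdeg_le_one_of_isAlgebraic_polynomial (K := K) (F := F)
  obtain ⟨D, hD⟩ := exists_derivation_algebraMap_X_eq_one (K := K) (F := F) L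
  have hD0 : D ≠ 0 := fun h0 => one_ne_zero (α := F) (by rw [← hD, h0, Derivation.zero_apply])
  have : Algebra.EssFiniteType K[X] L := .of_isLocalization _ (nonZeroDivisors K[X])
  have : Algebra.EssFiniteType K[X] F := .comp K[X] L F
  have : Algebra.EssFiniteType K F := .comp K K[X] F
  have hh' : algebraMap K[X] F h ≠ 0 := by rwa [Ne, map_eq_zero_iff _ hinj]
  refine Derivation.eq_zero_of_sum_smul_div_eq_zero htr D
    (fun x hx => Derivation.mem_range_of_apply_eq_zero htr D hD0 hx) _ hf hind e ?_
  have hDβ : aeval β (derivX K g) + aeval β (derivative g) * D β = 0 := by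
    rw [← Derivation.map_aeval_bivariate D hD, (hβ g).2 dvd_rfl, map_zero]
  have hC : ∀ c : K, aeval β (C (C c) : K[X][X]) = algebraMap K F c := fun c => by
    rw [aeval_C, IsScalarTower.algebraMap_apply K K[X] F, Polynomial.algebraMap_eq]
  have h1 : aeval β (derivative g) * algebraMap K[X] F h *
      ∑ j, e j • (D (aeval β (f j)) / aeval β (f j)) = 0 := by
    rw [← (hβ _).2 he, map_sum, Finset.mul_sum]
    refine Finset.sum_congr rfl fun j _ => ?_
    rw [map_mul, hC, map_mul, map_sub, map_mul, map_mul, ← hf',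
      Derivation.map_aeval_bivariate D hD, Algebra.smul_def, div_eq_mul_inv]
    linear_combination aeval β (derivative (f j)) * algebraMap K[X] F h * (aeval β (f j))⁻¹ *
      algebraMap K F (e j) * hDβ
  exact (mul_eq_zero.1 h1).resolve_left (mul_ne_zero hg' hh')

end Field

section Field

variable {K F : Type*} [Field K] [Field F] [Algebra K F] [IsAlgClosed K]

theorem exists_algebraMap_units_of_zpow_eq_one {R : Subring F} (incl : Kˣ →* Rˣ)
    (hincl : ∀ c, ((incl c : R) : F) = algebraMap K F c) {N : ℤ} (hN : N ≠ 0) (v : Rˣ)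
    (hv : v ^ N = 1) : v ∈ incl.range := by
  have h1 : ((v : R) : F) ^ N.natAbs = 1 := by
    have h2 : v ^ N.natAbs = 1 := by
      rcases Int.natAbs_eq N with h | h
      · rwa [h, zpow_natCast] at hv
      · rwa [h, zpow_neg, inv_eq_one, zpow_natCast] at hv
    simpa using congrArg (fun u : Rˣ => ((u : R) : F)) h2
  have h3 : ((v : R) : F) ∈ (algebraMap K F).range := by
    by_contra h
    refine transcendental_of_notMem_range h ⟨X ^ N.natAbs - 1, ?_, by simp [h1]⟩
    exact X_pow_sub_C_ne_zero (Int.natAbs_pos.2 hN) 1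
  obtain ⟨c, hc⟩ := h3
  have hc0 : c ≠ 0 := by
    rintro rfl
    rw [map_zero] at hc
    rw [← hc, zero_pow (Int.natAbs_ne_zero.2 hN)] at h1
    exact zero_ne_one h1
  exact ⟨Units.mk0 c hc0, Units.ext (Subtype.ext (by rw [hincl, Units.val_mk0, hc]))⟩

variable [CharZero K] [Algebra K[X] F] [IsScalarTower K K[X] F]

/-- Specialization over an algebraically closed field of constants, for a function field of one
variable. -/
theorem exists_specialization_of_finiteDimensional (L : Type*) [Field L] [CharZero L]
    [Algebra K[X] L] [IsFractionRing K[X] L] [Algebra L F] [IsScalarTower K[X] L F]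
    [FiniteDimensional L F] {ι : Type*} [Fintype ι] (s : ι → F) (hs : ∀ i, s i ≠ 0) :
    ∃ (R : Subring F) (φ : R →+* K), (∀ c, ∃ h : algebraMap K F c ∈ R, φ ⟨_, h⟩ = c) ∧
      (∀ i, s i ∈ R ∧ (s i)⁻¹ ∈ R) ∧
      (∀ (n : ι → ℤ) (h : ∑ i, n i • s i ∈ R), φ ⟨_, h⟩ = 0 → ∑ i, n i • s i = 0) ∧
      ∀ (n : ι → ℤ) (h : ∏ i, s i ^ n i ∈ R), φ ⟨_, h⟩ = 1 → ∏ i, s i ^ n i = 1 := by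
  classical
  have hinj : Function.Injective (algebraMap K[X] F) := by
    rw [IsScalarTower.algebraMap_eq K[X] L F]
    exact (algebraMap L F).injective.comp (IsFractionRing.injective _ _)
  obtain ⟨g, β, hg, hgd, hprime, hβ, hden⟩ := exists_primitive_presentation (K := K) (F := F) (L := L)
  obtain ⟨h₀, hh₀, p, hp⟩ : ∃ h₀ : K[X], h₀ ≠ 0 ∧ ∃ p : ι → K[X][X],
      ∀ i, algebraMap K[X] F h₀ * s i = aeval β (p i) := by
    obtain ⟨h₀, hh₀, hp⟩ := exists_common_denominator (aeval (R := K[X]) β) s fun i => hden _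
    exact ⟨h₀, hh₀, Classical.skolem.1 hp⟩
  have hh₀' : algebraMap K[X] F h₀ ≠ 0 := by rwa [Ne, map_eq_zero_iff _ hinj]
  let f : Option ι → K[X][X] := fun k => k.elim (C h₀) p
  have hf : ∀ k, aeval β (f k) ≠ 0 := by
    rintro (_ | i)
    · simpa [f] using hh₀'
    · simp only [f, Option.elim_some, ← hp]
      exact mul_ne_zero hh₀' (hs i)
  let A : Option ι → Fˣ := fun k => Units.mk0 _ (hf k)
  let inclF : Kˣ →* Fˣ := Units.map (algebraMap K F)
  obtain ⟨J, hJ, N, hN, hn⟩ := exists_finset_independent_modulo inclF.range A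
  choose q c hqc using hn
  have hg' : aeval β (derivative g) ≠ 0 := by
    rw [Ne, hβ]
    intro hdvd
    have h1 := eq_zero_of_dvd_of_degree_lt hdvd (degree_derivative_lt hg.ne_zero)
    exact hgd (derivative_eq_zero.1 h1)
  obtain ⟨h, hh, hfh⟩ := exists_common_denominator (aeval (R := K[X]) β)
    (fun k : Option (Option ι) => k.elim (aeval β (derivative g))⁻¹ fun k => (aeval β (f k))⁻¹)
    fun k => hden _
  obtain ⟨G, hG⟩ := hfh none
  have hf' : ∀ k : Option ι, ∃ f' : K[X][X], algebraMap K[X] F h * (aeval β (f k))⁻¹ =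
    aeval β f' := fun k => hfh (some k)
  choose f' hf' using hf'
  let w : J → K[X][X] := fun j => (derivative g * derivX K (f j) - derivX K g * derivative (f j)) * f' j
  obtain ⟨T₀, hT₀, E, hadd⟩ :=
    exists_finite_set_forall_evalEval_eq_zero_imp_dvd hg hgd hprime p
  have : NeZero g.natDegree := ⟨hgd⟩
  obtain ⟨τ, b, hτ, hgτ, hhτ, hmul⟩ := exists_specialization_of_isAlgClosed g hg hgd h hh
    (fun j : J => f j) (fun j => f' j) w G
    (fun j => by
      rw [← hβ, map_sub, map_mul, ← hf', aeval_C]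
      field_simp [hf]
      simp)
    (by
      rw [← hβ, map_sub, map_mul, ← hG, aeval_C]
      simp only [Option.elim_none]
      field_simp
      simp)
    (fun j => by simp [w]) (fun j => powModMatrix g (w j))
    (fun j a => dvd_mul_X_pow_sub_powModMatrix hg hgd (w j) a)
    (fun e he => by
      rw [← powModMatrix_sum_smul]
      refine det_powModMatrix_ne_zero hg hgd hprime fun hdvd => he ?_
      refine eq_zero_of_dvd_sum_logDeriv L hβ hg' (fun j : J => f j) (fun j => f' j) (fun j => hf j)
        hh (fun j => hf' j) (fun m hm => hJ m ?_) e hdvd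
      obtain ⟨x, hx⟩ := hm
      have hx0 : x ≠ 0 := by
        rintro rfl
        rw [map_zero, eq_comm, Finset.prod_eq_zero_iff] at hx
        obtain ⟨j, -, hj⟩ := hx
        exact zpow_ne_zero _ (hf j) hj
      exact ⟨Units.mk0 x hx0, Units.ext (by simpa [inclF, A] using hx)⟩)
    c T₀ hT₀ E
  have hev : ∀ x : K[X][X], aeval β x = 0 → evalEvalRingHom τ b x = 0 := by
    intro x hx
    obtain ⟨y, rfl⟩ := (hβ x).1 hx
    rw [map_mul, coe_evalEvalRingHom, hgτ, zero_mul]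
  have hevh : evalEvalRingHom τ b (C h) ≠ 0 := by
    rwa [coe_evalEvalRingHom, evalEval_C]
  obtain ⟨R, φ, hφ⟩ := exists_subring_ringHom_of_ker_le
    (aeval (R := K[X]) β : K[X][X] →+* F) (evalEvalRingHom τ b) hev hevh
  have hθh : aeval β (C h) ≠ 0 := fun h0 => hevh (hev _ h0)
  have hφ' : ∀ x y, aeval β x = y → ∃ hy : y ∈ R, φ ⟨y, hy⟩ = x.evalEval τ b := by
    rintro x _ rfl
    obtain ⟨hx, hx'⟩ := hφ (x * C h)
    simp only [RingHom.coe_coe, map_mul, mul_div_cancel_right₀ _ hevh,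
      mul_div_cancel_right₀ _ hθh] at hx hx'
    exact ⟨hx, hx'⟩
  have hfinv : ∀ k, (aeval β (f k))⁻¹ ∈ R := by
    intro k
    obtain ⟨hx, -⟩ := hφ (f' k)
    rw [RingHom.coe_coe, ← hf', aeval_C, mul_div_cancel_left₀] at hx
    · exact hx
    · rwa [aeval_C] at hθh
  have hconst : ∀ c, ∃ h : algebraMap K F c ∈ R, φ ⟨_, h⟩ = c := by
    intro c
    obtain ⟨hx, hx'⟩ := hφ' (C (C c)) (algebraMap K F c) (by
      rw [aeval_C, IsScalarTower.algebraMap_apply K K[X] F, Polynomial.algebraMap_eq])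
    exact ⟨hx, by rw [hx', evalEval_C, eval_C]⟩
  let A' : Option ι → Rˣ := fun k => ⟨⟨_, (hφ' (f k) _ rfl).1⟩, ⟨_, hfinv k⟩,
    Subtype.ext (mul_inv_cancel₀ (hf k)), Subtype.ext (inv_mul_cancel₀ (hf k))⟩
  let toF : Rˣ →* F := (R.subtype : R →* F).comp (Units.coeHom R)
  have htoF : Function.Injective toF := fun u v huv => Units.ext (Subtype.ext huv)
  have htoFi : ∀ (u : Rˣ) (n : ℤ), toF (u ^ n) = toF u ^ n := fun u n => by
    change ((Units.map (R.subtype : R →* F) (u ^ n) : Fˣ) : F) =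
      ((Units.map (R.subtype : R →* F) u : Fˣ) : F) ^ n
    rw [map_zpow, Units.val_zpow_eq_zpow_val]
  have hsA : ∀ i, s i = toF (A' (some i) * (A' none)⁻¹) := fun i => by
    change s i = aeval β (p i) * (aeval β (C h₀))⁻¹
    rw [← hp, aeval_C]
    field_simp
  refine ⟨R, φ, hconst, fun i => ?_, fun n hn hn0 => ?_, fun n hn hn1 => ?_⟩
  · constructor
    · rw [hsA]
      exact (A' (some i) * (A' none)⁻¹).val.2
    · have : (s i)⁻¹ = toF ((A' (some i) * (A' none)⁻¹)⁻¹) := by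
        rw [hsA, ← zpow_neg_one, ← htoFi, zpow_neg_one]
      rw [this]
      exact ((A' (some i) * (A' none)⁻¹)⁻¹).val.2
  · have h1 : aeval β (∑ i, n i • p i) = algebraMap K[X] F h₀ * ∑ i, n i • s i := by
      simp only [map_sum, map_zsmul, ← hp, Finset.mul_sum, mul_smul_comm]
    obtain ⟨h2, h2'⟩ := hφ' _ _ h1
    obtain ⟨h3, -⟩ := hφ' (C h₀) (algebraMap K[X] F h₀) (aeval_C _ _)
    have h4 : (⟨_, h2⟩ : R) = ⟨_, h3⟩ * ⟨_, hn⟩ := rfl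
    rw [h4, map_mul, hn0, mul_zero] at h2'
    have h5 := (hβ _).2 (hadd τ b hτ hgτ n h2'.symm)
    rw [h1] at h5
    exact (mul_eq_zero.1 h5).resolve_left hh₀'
  · let incl : Kˣ →* Rˣ := Units.map
      (((algebraMap K F).codRestrict R fun c => (hconst c).1 : K →+* R) : K →* R)
    let ψ : Rˣ →* Kˣ := Units.map (φ : R →* K)
    let m : Option ι → ℤ := fun k => k.elim (-∑ i, n i) n
    have h1 : ∏ i, s i ^ n i = toF (∏ k, A' k ^ m k) := by
      have h2 : ∏ i, (A' none ^ n i)⁻¹ = A' none ^ (-∑ i, n i) := by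
        rw [Finset.prod_inv_distrib, zpow_neg, zpow_finsetSum]
      simp only [hsA, ← htoFi, ← map_prod]
      rw [Fintype.prod_option, mul_comm]
      simp only [mul_zpow, inv_zpow, m, Option.elim_some, Option.elim_none, ← h2,
        Finset.prod_mul_distrib]
    have h2 : ∏ k, A' k ^ m k = 1 := by
      refine prod_zpow_eq_one_of_retraction incl ψ (fun c => Units.ext (hconst c).2) A'
        (fun j : J => A' j) c q (fun k => htoF ?_) (fun n' m' hnm => ?_)
        (fun v hv => exists_algebraMap_units_of_zpow_eq_one incl (fun _ => rfl) hN v hv) m ?_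
      · simp only [map_mul, map_prod, htoFi]
        have h3 := congrArg Units.val (hqc k).symm
        simp only [Units.val_mul, Units.coe_prod, Units.val_zpow_eq_zpow_val] at h3
        exact h3
      · refine hmul (fun j => ψ (A' j)) (fun j => (hφ' (f j) _ rfl).2) n' m' hnm
      · refine Units.ext ?_
        exact (congrArg φ (Subtype.ext h1.symm)).trans hn1
    rw [h1, h2, map_one]

end Field

theorem exists_specialization_of_isAlgebraic_polynomial {K Ω : Type*} [Field K] [Field Ω]
    [Algebra K Ω] [IsAlgClosed K] [CharZero K] [Algebra K[X] Ω] [IsScalarTower K K[X] Ω]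
    [FaithfulSMul K[X] Ω] {s : Set Ω} (hs : s.Finite) (halg : ∀ x ∈ s, IsAlgebraic K[X] x) :
    ∃ (R : Subring Ω) (φ : R →+* K), (∀ c, ∃ h : algebraMap K Ω c ∈ R, φ ⟨_, h⟩ = c) ∧
      (∀ x ∈ s, x ∈ R ∧ x⁻¹ ∈ R) ∧
      (∀ x ∈ AddSubgroup.closure s, ∀ h : x ∈ R, φ ⟨x, h⟩ = 0 → x = 0) ∧
      ∀ u ∈ Subgroup.closure {u : Ωˣ | ↑u ∈ s}, ∀ h : ↑u ∈ R, φ ⟨u, h⟩ = 1 → u = 1 := by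
  let L := FractionRing K[X]
  let _ : Algebra L Ω := FractionRing.liftAlgebra K[X] Ω
  have : IsScalarTower K[X] L Ω := FractionRing.isScalarTower_liftAlgebra K[X] Ω
  have : CharZero L := charZero_of_injective_algebraMap (algebraMap K L).injective
  have : Finite s := hs
  have : FiniteDimensional L (IntermediateField.adjoin L s) :=
    IntermediateField.finiteDimensional_adjoin fun x hx => ((halg x hx).extendScalars
      (IsFractionRing.injective K[X] L)).isIntegral
  have : IsScalarTower K L Ω := .to₁₃₄ _ K[X] _ _
  let F := IntermediateField.adjoin L s
  have : IsScalarTower K K[X] F := .of_algebraMap_eq fun c => Subtype.ext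
    (IsScalarTower.algebraMap_apply K K[X] Ω c)
  have : IsScalarTower K[X] L F := .of_algebraMap_eq fun c => Subtype.ext
    (IsScalarTower.algebraMap_apply K[X] L Ω c)
  let ι := {x // x ∈ s ∧ x ≠ 0}
  have : Finite ι := (hs.subset (Set.sep_subset s (· ≠ 0))).to_subtype
  let _ : Fintype ι := Fintype.ofFinite ι
  let a : ι → F := fun i => ⟨i, IntermediateField.subset_adjoin L s i.2.1⟩
  obtain ⟨R, φ, hc, hmem, hadd, hmul⟩ := exists_specialization_of_finiteDimensional (K := K) L a
    fun i h => i.2.2 (congrArg Subtype.val h)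
  let v : F →+* Ω := algebraMap F Ω
  have hv : Function.Injective v := v.injective
  let e := Subring.equivMapOfInjective R v hv
  let φ' : R.map v →+* K := φ.comp e.symm
  have hφ' : ∀ (x : F) (hx : v x ∈ R.map v), ∃ h : x ∈ R, φ' ⟨v x, hx⟩ = φ ⟨x, h⟩ := by
    intro x hx
    obtain ⟨y, hy, hyx⟩ := hx
    obtain rfl := hv hyx
    exact ⟨hy, congrArg φ (e.symm_apply_apply ⟨y, hy⟩)⟩
  refine ⟨R.map v, φ', fun c => ?_, fun x hx => ?_, fun x hx hxR h0 => ?_, fun u hu huR h1 => ?_⟩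
  · obtain ⟨h, h'⟩ := hc c
    have h2 : algebraMap K Ω c ∈ R.map v := ⟨_, h, rfl⟩
    exact ⟨h2, (hφ' (algebraMap K F c) h2).2.trans h'⟩
  · by_cases hx0 : x = 0
    · simp [hx0, zero_mem]
    · exact ⟨⟨a ⟨x, hx, hx0⟩, (hmem _).1, rfl⟩, ⟨(a ⟨x, hx, hx0⟩)⁻¹, (hmem _).2, rfl⟩⟩
  · have hle : AddSubgroup.closure s ≤ AddSubgroup.closure (Set.range fun i : ι => (i : Ω)) := by
      refine (AddSubgroup.closure_le _).2 fun y hy => ?_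
      by_cases hy0 : y = 0
      · rw [hy0]
        exact zero_mem _
      · exact AddSubgroup.subset_closure ⟨⟨y, hy, hy0⟩, rfl⟩
    obtain ⟨n, hn⟩ := AddSubgroup.exists_of_mem_closure_range _ _ (hle hx)
    have hn' : x = v (∑ i, n i • a i) := by
      rw [hn, map_sum]
      simp only [map_zsmul]
      rfl
    subst hn'
    obtain ⟨h, h'⟩ := hφ' _ hxR
    rw [hadd n h (h'.symm.trans h0), map_zero]
  · let b : ι → Ωˣ := fun i => Units.mk0 i i.2.2
    have hle : {u : Ωˣ | ↑u ∈ s} ⊆ Set.range b := fun u hu => ⟨⟨u, hu, u.ne_zero⟩, Units.ext rfl⟩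
    obtain ⟨n, hn⟩ := Subgroup.exists_of_mem_closure_range b _ (Subgroup.closure_mono hle hu)
    have hn' : (u : Ω) = v (∏ i, a i ^ n i) := by
      rw [hn, map_prod, Units.coe_prod]
      simp only [map_zpow₀, Units.val_zpow_eq_zpow_val]
      rfl
    have h2 : ∀ h : v (∏ i, a i ^ n i) ∈ R.map v, φ' ⟨_, h⟩ = 1 := by
      rw [← hn']
      exact fun _ => h1
    have h3 := hn' ▸ huR
    obtain ⟨h, h'⟩ := hφ' _ h3
    refine Units.ext ?_
    rw [hn', hmul n h (h'.symm.trans (h2 h3)), map_one, Units.val_one]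

/-- There is a homomorphism to `K` from a subring of `Ω` that contains `K`, `s` and the inverses of
the elements of `s`, which fixes `K` and is injective on the additive and multiplicative groups
generated by `s`. -/
def HasSpecialization {Ω : Type*} [Field Ω] (K : Subfield Ω) (s : Set Ω) : Prop :=
  ∃ (R : Subring Ω) (φ : R →+* Ω), (∀ x, φ x ∈ K) ∧ (∀ x ∈ K, ∃ h : x ∈ R, φ ⟨x, h⟩ = x) ∧
    (∀ x ∈ s, x ∈ R ∧ x⁻¹ ∈ R) ∧
    (∀ x ∈ AddSubgroup.closure s, ∀ h : x ∈ R, φ ⟨x, h⟩ = 0 → x = 0) ∧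
    ∀ u ∈ Subgroup.closure {u : Ωˣ | ↑u ∈ s}, ∀ h : ↑u ∈ R, φ ⟨u, h⟩ = 1 → u = 1

section HasSpecialization

variable {Ω : Type*} [Field Ω]

theorem HasSpecialization.of_subset {K : Subfield Ω} {s : Set Ω} (hs : s ⊆ K) :
    HasSpecialization K s :=
  ⟨K.toSubring, K.subtype, fun x => x.2, fun _ hx => ⟨hx, rfl⟩,
    fun _ hx => ⟨hs hx, K.inv_mem (hs hx)⟩, fun _ _ _ h => h, fun _ _ _ h => Units.ext h⟩

theorem isAlgebraic_of_forall_mem_range {E : Subfield Ω} {L : Type*} [Field L] [Algebra L Ω]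
    (hE : ∀ y ∈ E, y ∈ (algebraMap L Ω).range) {x : Ω} (hx : IsAlgebraic E x) :
    IsAlgebraic L x := by
  obtain ⟨p, hp, hpx⟩ := hx
  obtain ⟨q, hq⟩ := (lifts_iff_coeff_lifts (f := algebraMap L Ω) (p.map (algebraMap E Ω))).2
    fun n => by
      rw [coeff_map]
      exact hE _ (p.coeff n).2
  rw [coe_mapRingHom] at hq
  refine ⟨q, ?_, ?_⟩
  · rintro rfl
    rw [Polynomial.map_zero, eq_comm,
      Polynomial.map_eq_zero_iff (algebraMap E Ω).injective] at hq
    exact hp hq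
  · rw [← hpx, aeval_def, aeval_def, ← eval_map, ← eval_map, hq]

theorem HasSpecialization.of_isAlgebraic_closure_insert [CharZero Ω] {K : Subfield Ω}
    [IsAlgClosed K] {t : Ω} {s : Set Ω} (hs : s.Finite)
    (halg : ∀ x ∈ s, IsAlgebraic (Subfield.closure (K ∪ {t} : Set Ω)) x) :
    HasSpecialization K s := by
  by_cases ht : t ∈ K
  · refine .of_subset fun x hx => ?_
    have h1 : IsAlgebraic K x := by
      refine isAlgebraic_of_forall_mem_range (fun y hy => ⟨⟨y, ?_⟩, rfl⟩) (halg x hx)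
      refine Subfield.closure_le.2 (Set.union_subset subset_rfl ?_) hy
      exact Set.singleton_subset_iff.2 ht
    by_contra hxK
    refine transcendental_of_notMem_range (K := K) (fun h => hxK ?_) h1
    obtain ⟨y, rfl⟩ := h
    exact y.2
  · have htr : Transcendental K t := transcendental_of_notMem_range fun h => ht (by
      obtain ⟨y, rfl⟩ := h
      exact y.2)
    let _ : Algebra K[X] Ω := (aeval (R := K) t).toAlgebra
    have hX : algebraMap K[X] Ω X = t := aeval_X t
    have : IsScalarTower K K[X] Ω := .of_algebraMap_eq fun c => (aeval_C t c).symm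
    have : FaithfulSMul K[X] Ω :=
      (faithfulSMul_iff_algebraMap_injective _ _).2 (transcendental_iff_injective.1 htr)
    let L := FractionRing K[X]
    let _ : Algebra L Ω := FractionRing.liftAlgebra K[X] Ω
    have : IsScalarTower K[X] L Ω := FractionRing.isScalarTower_liftAlgebra K[X] Ω
    have hle : Subfield.closure (K ∪ {t} : Set Ω) ≤ (algebraMap L Ω).fieldRange := by
      refine Subfield.closure_le.2 (Set.union_subset (fun y hy => ?_) ?_)
      · refine ⟨algebraMap K[X] L (C ⟨y, hy⟩), ?_⟩
        rw [← IsScalarTower.algebraMap_apply]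
        exact aeval_C t _
      · rw [Set.singleton_subset_iff]
        refine ⟨algebraMap K[X] L X, ?_⟩
        rw [← IsScalarTower.algebraMap_apply, hX]
    obtain ⟨R, φ, hc, hmem, hadd, hmul⟩ := exists_specialization_of_isAlgebraic_polynomial
      (K := K) hs fun x hx => (IsFractionRing.isAlgebraic_iff K[X] L Ω).2
        (isAlgebraic_of_forall_mem_range (fun y hy => hle hy) (halg x hx))
    refine ⟨R, K.subtype.comp φ, fun x => (φ x).2, fun x hx => ?_, hmem, fun x hx h h0 => ?_,
      fun u hu h h1 => ?_⟩
    · obtain ⟨h, h'⟩ := hc ⟨x, hx⟩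
      exact ⟨h, congrArg Subtype.val h'⟩
    · exact hadd x hx h (Subtype.ext h0)
    · exact hmul u hu h (Subtype.ext h1)

theorem HasSpecialization.trans {K K₁ : Subfield Ω} (hK : K ≤ K₁) {s : Set Ω} (hs : s.Finite)
    (h₁ : HasSpecialization K₁ s)
    (h₂ : ∀ s₁ : Set Ω, s₁.Finite → s₁ ⊆ K₁ → HasSpecialization K s₁) :
    HasSpecialization K s := by
  obtain ⟨R, φ, hφ, hc, hmem, hadd, hmul⟩ := h₁
  let s₁ : Set Ω := Set.range fun x : s => φ ⟨x, (hmem x x.2).1⟩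
  have : Finite s := hs
  obtain ⟨R', φ', hφ', hc', hmem', hadd', hmul'⟩ := h₂ s₁ (Set.finite_range _) (by
    rintro _ ⟨x, rfl⟩
    exact hφ _)
  let R'' : Subring Ω := (R'.comap φ).map R.subtype
  have hR'' : ∀ x, x ∈ R'' ↔ ∃ h : x ∈ R, φ ⟨x, h⟩ ∈ R' := fun x =>
    ⟨by rintro ⟨y, hy, rfl⟩; exact ⟨y.2, hy⟩, fun ⟨h, h'⟩ => ⟨⟨x, h⟩, h', rfl⟩⟩
  let i : R'' →+* R := (Subring.inclusion (by rintro _ ⟨y, -, rfl⟩; exact y.2))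
  let φ₁ : R'' →+* R' := (φ.comp i).codRestrict R' fun x => ((hR'' x).1 x.2).2
  have hinv : ∀ x (h : x ∈ R) (h' : x⁻¹ ∈ R), φ ⟨x⁻¹, h'⟩ = (φ ⟨x, h⟩)⁻¹ := by
    intro x h h'
    by_cases hx : x = 0
    · subst hx
      have h1 : (⟨0, h⟩ : R) = 0 := rfl
      have h2 : (⟨0⁻¹, h'⟩ : R) = 0 := Subtype.ext inv_zero
      rw [h1, h2, map_zero, inv_zero]
    · refine eq_inv_of_mul_eq_one_left ?_
      rw [← map_mul, ← map_one φ]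
      exact congrArg φ (Subtype.ext (inv_mul_cancel₀ hx))
  have haddcl : ∀ x ∈ AddSubgroup.closure s, ∃ h : x ∈ R, φ ⟨x, h⟩ ∈ AddSubgroup.closure s₁ := by
    intro x hx
    induction hx using AddSubgroup.closure_induction with
    | mem x h => exact ⟨(hmem x h).1, AddSubgroup.subset_closure ⟨⟨x, h⟩, rfl⟩⟩
    | zero => exact ⟨R.zero_mem, by
        have : (⟨0, R.zero_mem⟩ : R) = 0 := rfl
        rw [this, map_zero]
        exact zero_mem _⟩
    | add x y hx hy hx' hy' =>
      obtain ⟨h, h'⟩ := hx'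
      obtain ⟨k, k'⟩ := hy'
      exact ⟨add_mem h k, (map_add φ ⟨x, h⟩ ⟨y, k⟩).symm ▸ add_mem h' k'⟩
    | neg x hx hx' =>
      obtain ⟨h, h'⟩ := hx'
      exact ⟨neg_mem h, (map_neg φ ⟨x, h⟩).symm ▸ neg_mem h'⟩
  have hmulcl : ∀ u ∈ Subgroup.closure {u : Ωˣ | ↑u ∈ s},
      ∃ w ∈ Subgroup.closure {u : Ωˣ | ↑u ∈ s₁}, ∃ h : ↑u ∈ R, ∃ _ : ↑u⁻¹ ∈ R,
        φ ⟨u, h⟩ = (w : Ω) := by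
    intro u hu
    induction hu using Subgroup.closure_induction with
    | mem u h =>
      have h1 := hmem u h
      have h2 : φ ⟨u, h1.1⟩ ≠ 0 := by
        exact fun h0 => u.ne_zero (hadd u (AddSubgroup.subset_closure h) _ h0)
      refine ⟨Units.mk0 _ h2, Subgroup.subset_closure ⟨⟨u, h⟩, rfl⟩, h1.1, ?_, rfl⟩
      rw [Units.val_inv_eq_inv_val]
      exact h1.2
    | one => exact ⟨1, one_mem _, one_mem _, by simp [one_mem], map_one φ⟩
    | mul u v hu hv hu' hv' =>
      obtain ⟨w, hw, h, h', hφ⟩ := hu'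
      obtain ⟨x, hx, k, k', kφ⟩ := hv'
      refine ⟨w * x, mul_mem hw hx, mul_mem h k, ?_, ?_⟩
      · rw [mul_inv]
        exact mul_mem h' k'
      · exact (map_mul φ ⟨u, h⟩ ⟨v, k⟩).trans ((congrArg₂ _ hφ kφ).trans (Units.val_mul w x).symm)
    | inv u hu hu' =>
      obtain ⟨w, hw, h, h', hφ⟩ := hu'
      refine ⟨w⁻¹, inv_mem hw, h', by rwa [inv_inv], ?_⟩
      have h'' : (u : Ω)⁻¹ ∈ R := by rwa [← Units.val_inv_eq_inv_val]
      have h1 : (⟨↑u⁻¹, h'⟩ : R) = ⟨(u : Ω)⁻¹, h''⟩ := Subtype.ext (Units.val_inv_eq_inv_val u)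
      rw [h1, hinv _ h, hφ, Units.val_inv_eq_inv_val]
  refine ⟨R'', φ'.comp φ₁, fun x => hφ' _, fun x hx => ?_, fun x hx => ?_, fun x hx h h0 => ?_,
    fun u hu h h1 => ?_⟩
  · obtain ⟨h, h'⟩ := hc x (hK hx)
    obtain ⟨k, k'⟩ := hc' x hx
    have hR := (hR'' x).2 ⟨h, h'.symm ▸ k⟩
    refine ⟨hR, ?_⟩
    have : φ₁ ⟨x, hR⟩ = ⟨x, k⟩ := Subtype.ext h'
    rw [RingHom.comp_apply, this, k']
  · have h1 := hmem' _ ⟨⟨x, hx⟩, rfl⟩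
    refine ⟨(hR'' _).2 ⟨(hmem x hx).1, h1.1⟩, (hR'' _).2 ⟨(hmem x hx).2, ?_⟩⟩
    rw [hinv x (hmem x hx).1]
    exact h1.2
  · obtain ⟨k, hk⟩ := haddcl x hx
    exact hadd x hx k (hadd' _ hk ((hR'' x).1 h).2 h0)
  · obtain ⟨w, hw, k, -, hkw⟩ := hmulcl u hu
    refine hmul u hu k ?_
    rw [hkw, ← Units.val_one, Units.val_inj]
    refine hmul' w hw (hkw ▸ ((hR'' u).1 h).2) ?_
    rw [← h1]
    exact congrArg φ' (Subtype.ext hkw.symm)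

theorem hasSpecialization_of_isAlgebraic_closure [CharZero Ω] [IsAlgClosed Ω] {K : Subfield Ω}
    (hK : ∀ x : Ω, IsAlgebraic K x → x ∈ K) {T : Set Ω} (hT : T.Finite) :
    ∀ {s : Set Ω}, s.Finite → (∀ x ∈ s, IsAlgebraic (Subfield.closure (K ∪ T : Set Ω)) x) →
      HasSpecialization K s := by
  induction T, hT using Set.Finite.induction_on with
  | empty =>
    refine fun _ halg => .of_subset fun x hx => hK x ?_
    refine isAlgebraic_of_forall_mem_range (fun y hy => ⟨⟨y, ?_⟩, rfl⟩) (halg x hx)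
    rwa [Set.union_empty, Subfield.closure_eq] at hy
  | @insert t T _ _ ih =>
    intro s hs halg
    let E := Subfield.closure (K ∪ T : Set Ω)
    let K₁ : Subfield Ω := (algebraicClosure E Ω).toSubfield
    have hE : E ≤ K₁ := fun x hx => (algebraicClosure E Ω).algebraMap_mem ⟨x, hx⟩
    have hKE : (K : Set Ω) ⊆ E := Set.subset_union_left.trans Subfield.subset_closure
    have : IsAlgClosed K₁ := IsAlgClosure.isAlgClosed (K := algebraicClosure E Ω) E
    refine .trans (fun x hx => hE (hKE hx)) hs
      (.of_isAlgebraic_closure_insert (t := t) hs fun x hx => ?_)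
      fun s₁ hs₁ hs₁K => ih hs₁ fun x hx => mem_algebraicClosure_iff.1 (hs₁K hx)
    refine isAlgebraic_of_forall_mem_range (fun y hy => ⟨⟨y, ?_⟩, rfl⟩) (halg x hx)
    refine Subfield.closure_le.2 (Set.union_subset ?_ (Set.insert_subset ?_ ?_)) hy
    · exact fun z hz => Subfield.subset_closure (Or.inl (hE (hKE hz)))
    · exact Subfield.subset_closure (Or.inr rfl)
    · exact fun z hz => Subfield.subset_closure (Or.inl (hE (Subfield.subset_closure (Or.inr hz))))

/-- Every finite subset of `Ω` has a specialization over a relatively algebraically closed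
subfield. -/
theorem hasSpecialization_of_finite [CharZero Ω] [IsAlgClosed Ω] {K : Subfield Ω}
    (hK : ∀ x : Ω, IsAlgebraic K x → x ∈ K) {s : Set Ω} (hs : s.Finite) :
    HasSpecialization K s :=
  hasSpecialization_of_isAlgebraic_closure hK hs hs fun x hx =>
    isAlgebraic_algebraMap (⟨x, Subfield.subset_closure (Or.inr hx)⟩ :
      Subfield.closure (K ∪ s : Set Ω))

end HasSpecialization

end

/-- Every finite subset of `Ω` is contained in the units of a `k`-subalgebra, up to zero, with a
homomorphism to `k̄` injective on the groups it generates. -/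
theorem exists_algHom_of_finite {Ω : Type*} [Field Ω] [IsAlgClosed Ω] [CharZero Ω]
    (k : Type*) [Field k] [Algebra k Ω]
    (kbar : Type*) [Field kbar] [Algebra k kbar] [IsAlgClosure k kbar] {s : Set Ω}
    (hs : s.Finite) : ∃ (A : Subalgebra k Ω) (φ : A →ₐ[k] kbar), (∀ x ∈ s, x ∈ A ∧ x⁻¹ ∈ A) ∧
      (∀ x ∈ AddSubgroup.closure s, ∀ h : x ∈ A, φ ⟨x, h⟩ = 0 → x = 0) ∧
      ∀ u ∈ Subgroup.closure {u : Ωˣ | ↑u ∈ s}, ∀ h : ↑u ∈ A, φ ⟨u, h⟩ = 1 → u = 1 := by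
  let K := algebraicClosure k Ω
  have hK : ∀ x : Ω, IsAlgebraic K.toSubfield x → x ∈ K.toSubfield := fun x hx => by
    have h : IsIntegral K x := IsAlgebraic.isIntegral hx
    exact mem_algebraicClosure_iff'.2 (isIntegral_trans x h)
  obtain ⟨R, φ, hφ, hc, hmem, hadd, hmul⟩ := hasSpecialization_of_finite hK hs
  have hk : ∀ c : k, algebraMap k Ω c ∈ K.toSubfield := K.algebraMap_mem
  let A : Subalgebra k Ω := { R with algebraMap_mem' := fun c => (hc _ (hk c)).1 }
  let φ' : A →ₐ[k] K :=
    { (RingHom.codRestrict φ K.toSubfield hφ : R →+* K.toSubfield) with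
      commutes' := fun c => Subtype.ext (hc _ (hk c)).2 }
  let e : K ≃ₐ[k] kbar := IsAlgClosure.equiv k K kbar
  refine ⟨A, e.toAlgHom.comp φ', hmem, fun x hx h h0 => hadd x hx h ?_,
    fun u hu h h1 => hmul u hu h ?_⟩
  · have h2 : φ' ⟨x, h⟩ = 0 := e.injective (h0.trans (map_zero e).symm)
    exact congrArg Subtype.val h2
  · have h2 : φ' ⟨u, h⟩ = 1 := e.injective (h1.trans (map_one e).symm)
    exact congrArg Subtype.val h2

/-- A finitely generated group is controlled by a finite set of generators. -/
theorem IsFGAddOrMulSubgroup.exists_finite {Ω : Type*} [Field Ω] {Γ : Set Ω}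
    (hΓ : IsFGAddOrMulSubgroup Γ) : ∃ t : Set Ω, t.Finite ∧ ∀ s, t ⊆ s →
      ∀ {k kbar : Type*} [Field k] [Algebra k Ω] [Field kbar] [Algebra k kbar]
        (A : Subalgebra k Ω) (φ : A →ₐ[k] kbar), (∀ x ∈ s, x ∈ A ∧ x⁻¹ ∈ A) →
        (∀ x ∈ AddSubgroup.closure s, ∀ h : x ∈ A, φ ⟨x, h⟩ = 0 → x = 0) →
        (∀ u ∈ Subgroup.closure {u : Ωˣ | ↑u ∈ s}, ∀ h : ↑u ∈ A, φ ⟨u, h⟩ = 1 → u = 1) →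
        ∃ h : Γ ⊆ A, ∀ a b (ha : a ∈ Γ) (hb : b ∈ Γ), φ ⟨a, h ha⟩ = φ ⟨b, h hb⟩ → a = b := by
  obtain ⟨H, ⟨S, rfl⟩, rfl⟩ | ⟨H, ⟨S, rfl⟩, rfl⟩ := hΓ
  · refine ⟨S, S.finite_toSet, fun s hs k kbar _ _ _ _ A φ hmem hadd _ => ?_⟩
    have hle : AddSubgroup.closure (S : Set Ω) ≤ A.toSubring.toAddSubgroup :=
      (AddSubgroup.closure_le _).2 fun x hx => (hmem x (hs hx)).1
    refine ⟨hle, fun a b ha hb hab => sub_eq_zero.1 ?_⟩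
    refine hadd _ (AddSubgroup.closure_mono hs (sub_mem ha hb)) (sub_mem (hle ha) (hle hb)) ?_
    exact (map_sub φ ⟨a, hle ha⟩ ⟨b, hle hb⟩).trans (sub_eq_zero.2 hab)
  · refine ⟨Units.val '' (S : Set Ωˣ), S.finite_toSet.image _,
      fun s hs k kbar _ _ _ _ A φ hmem _ hmul => ?_⟩
    have hS : (S : Set Ωˣ) ⊆ {u : Ωˣ | ↑u ∈ s} := fun u hu => hs ⟨u, hu, rfl⟩
    have hle : ∀ u ∈ Subgroup.closure (S : Set Ωˣ), (u : Ω) ∈ A ∧ (↑u⁻¹ : Ω) ∈ A := by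
      intro u hu
      induction hu using Subgroup.closure_induction with
      | mem u h => simpa using hmem u (hS h)
      | one => simp [one_mem]
      | mul u v _ _ hu hv =>
        rw [mul_inv]
        exact ⟨mul_mem hu.1 hv.1, mul_mem hu.2 hv.2⟩
      | inv u _ hu => rwa [inv_inv, and_comm]
    refine ⟨?_, ?_⟩
    · rintro _ ⟨u, hu, rfl⟩
      exact (hle u hu).1
    · rintro _ _ ⟨u, hu, rfl⟩ ⟨v, hv, rfl⟩ huv
      rw [Units.val_inj, ← div_eq_one]
      have hdiv := div_mem hu hv
      refine hmul _ (Subgroup.closure_mono hS hdiv) (hle _ hdiv).1 ?_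
      have h1 : (⟨v, (hle v hv).1⟩ : A) * ⟨_, (hle v hv).2⟩ = 1 := Subtype.ext v.mul_inv
      have h2 : (⟨_, (hle _ hdiv).1⟩ : A) = ⟨u, (hle u hu).1⟩ * ⟨_, (hle v hv).2⟩ :=
        Subtype.ext (by simp [div_eq_mul_inv])
      rw [h2, map_mul, huv, ← map_mul, h1, map_one]

/-- Corollary 2.21 of the paper. For any subfield `k` of `Ω` and any
finitely generated `k`-algebra `D ⊆ Ω`, every basic open subset of `Hom_k(D,k̄)` is Zariski
dense; in particular, every basic open subset of `Hom_k(D,k̄)` is nonempty. -/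
theorem basicOpen_zariskiDense
    {Ω : Type*} [Field Ω] [IsAlgClosed Ω] [CharZero Ω]
    (k : Type*) [Field k] [Algebra k Ω]
    (kbar : Type*) [Field kbar] [Algebra k kbar] [IsAlgClosure k kbar]
    (D : Subalgebra k Ω) (hD : D.FG) :
    ∀ U : Set (↥D →ₐ[k] kbar), IsBasicOpen k kbar D U →
      ZariskiDense k kbar D U ∧ U.Nonempty := by
  rintro _ ⟨S, -, hS, rfl⟩
  have key : ∀ a : D, a ≠ 0 → ∃ φ ∈ ⋂ Γ ∈ S, specB k kbar D Γ, φ a ≠ 0 := by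
    intro a ha
    obtain ⟨d, rfl⟩ := hD
    choose! t ht htΓ using fun Γ hΓ => (hS Γ hΓ).exists_finite
    let s : Set Ω := insert (a : Ω) (d ∪ ⋃ Γ ∈ S, t Γ)
    have hs : s.Finite := .insert _ (d.finite_toSet.union (S.finite_toSet.biUnion ht))
    obtain ⟨A, φ, hmem, hadd, hmul⟩ := exists_algHom_of_finite k kbar hs
    have hDA : Algebra.adjoin k (d : Set Ω) ≤ A :=
      Algebra.adjoin_le fun x hx => (hmem x (Or.inr (Or.inl hx))).1
    refine ⟨φ.comp (Subalgebra.inclusion hDA), Set.mem_iInter₂.2 fun Γ hΓ => ?_, fun h0 => ha ?_⟩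
    · have hts : t Γ ⊆ s := fun x hx => Or.inr (Or.inr (Set.mem_biUnion hΓ hx))
      obtain ⟨hΓA, hinj⟩ := htΓ Γ hΓ s hts A φ hmem hadd hmul
      exact ⟨φ.comp (Subalgebra.inclusion (Algebra.adjoin_le (Set.union_subset hDA hΓA))),
        hinj, rfl⟩
    · exact Subtype.ext (hadd a (AddSubgroup.subset_closure (Or.inl rfl)) (hDA a.2) h0)
  refine ⟨fun I hI => ?_, ?_⟩
  · refine Set.eq_univ_of_forall fun φ a ha => ?_
    by_cases h0 : a = 0
    · rw [h0, map_zero]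
    · obtain ⟨ψ, hψ, hψa⟩ := key a h0
      exact absurd (hI hψ a ha) hψa
  · obtain ⟨φ, hφ, -⟩ := key 1 one_ne_zero
    exact ⟨φ, hφ⟩
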